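/- arXiv:2407.19444 — 6 statements merged into one kernel-verified Lean document; each statement's English description precedes it below -/
import Mathlib

section
/- Given any measure preserving system (X, μ, T) and any measurable set A ⊆ X, there exists a set E ⊆ ℕ such that for all k ≥ 1 and all n₁, …, n_k ∈ ℕ, the limit lim_{N→∞} |((E − n₁) ∩ … ∩ (E − n_k)) ∩ {0, 1, …, N−1}| / N exists and equals μ(T^{−n₁}A ∩ … ∩ T^{−n_k}A). (Here E − n denotes {m ∈ ℕ : m + n ∈ E}.) -/
open MeasureTheory Filter
open scoped Classical

section GreedySelection

variable {X ι : Type*} [MeasurableSpace X] [Encodable ι]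

lemma summable_geometric_mul_sq {D : ι → ℝ} {M : ℝ} (hD : ∀ i, |D i| ≤ M) :
    Summable fun i => (1 / 2 : ℝ) ^ Encodable.encode i * D i ^ 2 := by
  refine Summable.of_nonneg_of_le (fun i => by positivity) (fun i => ?_)
    (summable_geometric_two_encode.mul_right (M ^ 2))
  exact mul_le_mul_of_nonneg_left
    (sq_le_sq' (neg_le_of_abs_le (hD i)) (le_of_abs_le (hD i))) (by positivity)

/-- Adding a centred bounded family at a suitable point increases the weighted sum of squares
by at most the second moment bound. -/
lemma exists_tsum_sq_add_le (μ : Measure X) [IsProbabilityMeasure μ]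
    {D : ι → ℝ} {M b : ℝ} (hD : ∀ i, |D i| ≤ M) {V : ι → X → ℝ}
    (hVm : ∀ i, Measurable (V i)) (hVb : ∀ i x, |V i x| ≤ b) (hV0 : ∀ i, ∫ x, V i x ∂μ = 0) :
    ∃ x, ∑' i, (1 / 2 : ℝ) ^ Encodable.encode i * (D i + V i x) ^ 2 ≤
      (∑' i, (1 / 2 : ℝ) ^ Encodable.encode i * D i ^ 2) +
        (∑' i : ι, (1 / 2 : ℝ) ^ Encodable.encode i) * b ^ 2 := by
  have hDV : ∀ i x, |D i + V i x| ≤ M + b := fun i x =>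
    (abs_add_le _ _).trans (add_le_add (hD i) (hVb i x))
  have hVi : ∀ i, Integrable (V i) μ := fun i =>
    .of_bound (hVm i).aestronglyMeasurable b (ae_of_all _ fun x => by simpa using hVb i x)
  have hVi2 : ∀ i, Integrable (fun x => V i x ^ 2) μ := fun i =>
    .of_bound ((hVm i).pow_const 2).aestronglyMeasurable (b ^ 2) (ae_of_all _ fun x => by
      rw [Real.norm_eq_abs, abs_pow]
      exact pow_le_pow_left₀ (abs_nonneg _) (hVb i x) 2)
  have hfi : ∀ i, Integrable
      (fun x => (1 / 2 : ℝ) ^ Encodable.encode i * (D i + V i x) ^ 2) μ := fun i => by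
    have : (fun x => (1 / 2 : ℝ) ^ Encodable.encode i * (D i + V i x) ^ 2) = fun x =>
        (1 / 2 : ℝ) ^ Encodable.encode i * (D i ^ 2 + 2 * D i * V i x + V i x ^ 2) := by
      ext x; ring
    rw [this]
    exact ((((integrable_const _).add ((hVi i).const_mul _)).add (hVi2 i)).const_mul _)
  have hint : ∀ i, ∫ x, (1 / 2 : ℝ) ^ Encodable.encode i * (D i + V i x) ^ 2 ∂μ ≤
      (1 / 2 : ℝ) ^ Encodable.encode i * D i ^ 2 + (1 / 2 : ℝ) ^ Encodable.encode i * b ^ 2 := by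
    intro i
    rw [integral_const_mul, ← mul_add]
    gcongr
    have h1 : ∫ x, (D i + V i x) ^ 2 ∂μ = D i ^ 2 + ∫ x, V i x ^ 2 ∂μ := by
      have : (fun x => (D i + V i x) ^ 2) =
          fun x => (D i ^ 2 + 2 * D i * V i x) + V i x ^ 2 := by ext x; ring
      have hlin : Integrable (fun x => 2 * D i * V i x) μ := (hVi i).const_mul _
      have haff : Integrable (fun x => D i ^ 2 + 2 * D i * V i x) μ :=
        (integrable_const _).add hlin
      rw [this, integral_add haff (hVi2 i), integral_add (integrable_const _) hlin,
        integral_const_mul, hV0]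
      simp
    rw [h1]
    gcongr
    calc ∫ x, V i x ^ 2 ∂μ ≤ ∫ _, b ^ 2 ∂μ :=
          integral_mono (hVi2 i) (integrable_const _) fun x =>
            sq_le_sq' (neg_le_of_abs_le (hVb i x)) (le_of_abs_le (hVb i x))
      _ = b ^ 2 := by simp
  have hw := summable_geometric_two_encode (ι := ι)
  have hnorm : ∀ i x, ‖(1 / 2 : ℝ) ^ Encodable.encode i * (D i + V i x) ^ 2‖ =
      (1 / 2 : ℝ) ^ Encodable.encode i * (D i + V i x) ^ 2 := fun i x =>
    Real.norm_of_nonneg (by positivity)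
  have hub := (summable_geometric_mul_sq hD).add (hw.mul_right (b ^ 2))
  have hsum : Summable fun i =>
      ∫ x, (1 / 2 : ℝ) ^ Encodable.encode i * (D i + V i x) ^ 2 ∂μ :=
    Summable.of_nonneg_of_le (fun i => integral_nonneg fun x => by positivity) hint hub
  have hsum' : Summable fun i =>
      ∫ x, ‖(1 / 2 : ℝ) ^ Encodable.encode i * (D i + V i x) ^ 2‖ ∂μ := by
    simpa only [hnorm] using hsum
  have hswap := hasSum_integral_of_summable_integral_norm hfi hsum'
  have htot : Integrable
      (fun x => ∑' i, (1 / 2 : ℝ) ^ Encodable.encode i * (D i + V i x) ^ 2) μ := by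
    refine .of_bound (C := ∑' i : ι, (1 / 2 : ℝ) ^ Encodable.encode i * (M + b) ^ 2) ?_ ?_
    · exact (Measurable.tsum fun i =>
        (((hVm i).const_add (D i)).pow_const 2).const_mul _).aestronglyMeasurable
    · refine ae_of_all _ fun x => ?_
      rw [Real.norm_of_nonneg (tsum_nonneg fun i => by positivity)]
      refine (summable_geometric_mul_sq fun i => hDV i x).tsum_le_tsum (fun i => ?_)
        (hw.mul_right _)
      exact mul_le_mul_of_nonneg_left
        (sq_le_sq' (neg_le_of_abs_le (hDV i x)) (le_of_abs_le (hDV i x))) (by positivity)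
  obtain ⟨x, hx⟩ := exists_le_integral htot
  refine ⟨x, hx.trans ?_⟩
  rw [← hswap.tsum_eq, ← tsum_mul_right, ← (summable_geometric_mul_sq hD).tsum_add
    (hw.mul_right _)]
  exact hsum.tsum_le_tsum hint hub

/-- A derandomised law of large numbers: points can be chosen so that countably many sums of
centred bounded functions are simultaneously of square-root size. -/
theorem exists_seq_sum_sq_le (μ : Measure X) [IsProbabilityMeasure μ]
    {V : ℕ → ι → X → ℝ} {b : ℕ → ℝ} (hVm : ∀ j i, Measurable (V j i))
    (hVb : ∀ j i x, |V j i x| ≤ b j) (hV0 : ∀ j i, ∫ x, V j i x ∂μ = 0) :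
    ∃ x : ℕ → X, ∀ i, ∃ C : ℝ, 0 ≤ C ∧ ∀ J : ℕ,
      (∑ j ∈ Finset.range J, V j i (x j)) ^ 2 ≤ C * ∑ j ∈ Finset.range J, b j ^ 2 := by
  choose f hf using fun (j : ℕ) (D : {D : ι → ℝ // ∃ M, ∀ i, |D i| ≤ M}) =>
    exists_tsum_sq_add_le μ D.2.choose_spec (hVm j) (hVb j) (hV0 j)
  let S : ℕ → {D : ι → ℝ // ∃ M, ∀ i, |D i| ≤ M} := fun J => Nat.rec ⟨0, 0, by simp⟩
    (fun j D => ⟨fun i => D.1 i + V j i (f j D), D.2.choose + b j, fun i =>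
      (abs_add_le _ _).trans (add_le_add (D.2.choose_spec i) (hVb j i _))⟩) J
  have hS : ∀ J i, (S J).1 i = ∑ j ∈ Finset.range J, V j i (f j (S j)) := by
    intro J i
    induction J with
    | zero => rfl
    | succ J ih => rw [Finset.sum_range_succ, ← ih]
  set W : ℝ := ∑' i : ι, (1 / 2 : ℝ) ^ Encodable.encode i
  have hΦ : ∀ J, ∑' i, (1 / 2 : ℝ) ^ Encodable.encode i * (S J).1 i ^ 2 ≤
      W * ∑ j ∈ Finset.range J, b j ^ 2 := by
    intro J
    induction J with
    | zero => simp [S]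
    | succ J ih =>
      rw [Finset.sum_range_succ, mul_add]
      exact (hf J (S J)).trans (by gcongr)
  refine ⟨fun j => f j (S j), fun i => ⟨2 ^ Encodable.encode i * W, ?_, fun J => ?_⟩⟩
  · exact mul_nonneg (by positivity) (tsum_nonneg fun i => by positivity)
  · rw [← hS]
    have h1 : (1 / 2 : ℝ) ^ Encodable.encode i * (S J).1 i ^ 2 ≤
        W * ∑ j ∈ Finset.range J, b j ^ 2 :=
      ((summable_geometric_mul_sq (S J).2.choose_spec).le_tsum i
        fun _ _ => by positivity).trans (hΦ J)
    have h2 : (2 : ℝ) ^ Encodable.encode i * (1 / 2) ^ Encodable.encode i = 1 := by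
      rw [← mul_pow]; norm_num
    calc (S J).1 i ^ 2
        = 2 ^ Encodable.encode i * ((1 / 2 : ℝ) ^ Encodable.encode i * (S J).1 i ^ 2) := by
          rw [← mul_assoc, h2, one_mul]
      _ ≤ 2 ^ Encodable.encode i * (W * ∑ j ∈ Finset.range J, b j ^ 2) := by gcongr
      _ = _ := by ring

end GreedySelection

section TriangularBlocks

/-- The starting point of the `j`-th block when `ℕ` is cut into blocks of lengths `1, 2, 3, …`. -/
def blockStart (j : ℕ) : ℕ := ∑ i ∈ Finset.range j, (i + 1)

lemma blockStart_succ (j : ℕ) : blockStart (j + 1) = blockStart j + (j + 1) :=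
  Finset.sum_range_succ _ _

lemma two_mul_blockStart (j : ℕ) : 2 * blockStart j = j * (j + 1) := by
  induction j with
  | zero => simp [blockStart]
  | succ j ih => rw [blockStart_succ, mul_add, ih]; ring

lemma blockStart_mono : Monotone blockStart :=
  monotone_nat_of_le_succ fun j => by rw [blockStart_succ]; omega

lemma exists_eq_blockStart_add (N : ℕ) : ∃ j m, m ≤ j ∧ N = blockStart j + m := by
  induction N with
  | zero => exact ⟨0, 0, le_rfl, by simp [blockStart]⟩
  | succ N ih =>
    obtain ⟨j, m, hm, rfl⟩ := ih
    rcases hm.lt_or_eq with h | rfl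
    · exact ⟨j, m + 1, h, rfl⟩
    · exact ⟨m + 1, 0, Nat.zero_le _, by rw [blockStart_succ]; omega⟩

lemma blockStart_add_inj {j j' m m' : ℕ} (hm : m ≤ j) (hm' : m' ≤ j')
    (h : blockStart j + m = blockStart j' + m') : j = j' ∧ m = m' := by
  have key : ∀ {a b c d : ℕ}, c ≤ a → blockStart a + c = blockStart b + d → ¬ a < b := by
    intro a b c d hc h hab
    have := blockStart_mono (Nat.succ_le_of_lt hab)
    rw [Nat.succ_eq_add_one, blockStart_succ] at this
    omega
  have h1 : j = j' := le_antisymm (not_lt.1 (key hm' h.symm)) (not_lt.1 (key hm h))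
  subst h1
  exact ⟨rfl, by omega⟩

lemma sum_range_blockStart (v : ℕ → ℝ) (J : ℕ) :
    ∑ m ∈ Finset.range (blockStart J), v m =
      ∑ j ∈ Finset.range J, ∑ m ∈ Finset.range (j + 1), v (blockStart j + m) := by
  induction J with
  | zero => simp [blockStart]
  | succ J ih =>
    rw [blockStart_succ, Finset.sum_range_add, ih,
      Finset.sum_range_succ (fun j => ∑ m ∈ Finset.range (j + 1), v (blockStart j + m))]

lemma abs_sum_range_le_card {v : ℕ → ℝ} (hv : ∀ m, |v m| ≤ 1) (N : ℕ) :
    |∑ m ∈ Finset.range N, v m| ≤ N := by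
  refine (Finset.abs_sum_le_sum_abs _ _).trans ?_
  simpa using Finset.sum_le_sum fun m (_ : m ∈ Finset.range N) => hv m

/-- Cesàro convergence to `0` of a bounded sequence follows from an `O(J ^ (3 / 2))` bound on its
sums over the first `J` blocks. -/
lemma tendsto_sum_div_of_blockStart {v : ℕ → ℝ} (hv : ∀ m, |v m| ≤ 1) {d K : ℝ} (hd : 0 ≤ d)
    (hK : 0 ≤ K) (h : ∀ J : ℕ, |∑ m ∈ Finset.range (blockStart J), v m| ≤
      d * J + K * √((J : ℝ) ^ 3)) :
    Tendsto (fun N : ℕ => (∑ m ∈ Finset.range N, v m) / N) atTop (nhds 0) := by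
  set r : ℕ → ℝ := fun N => √(√(2 * N))
  have hr : Tendsto (fun N => (r N)⁻¹) atTop (nhds 0) :=
    tendsto_inv_atTop_zero.comp (Real.tendsto_sqrt_atTop.comp (Real.tendsto_sqrt_atTop.comp
      (tendsto_natCast_atTop_atTop.const_mul_atTop two_pos)))
  have hlim : Tendsto (fun N => 2 * (d + 1) * (r N)⁻¹ ^ 2 + 2 * K * (r N)⁻¹) atTop (nhds 0) := by
    simpa using ((hr.pow 2).const_mul (2 * (d + 1))).add (hr.const_mul (2 * K))
  refine squeeze_zero_norm' ?_ hlim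
  filter_upwards [eventually_gt_atTop 0] with N hN
  have hN' : (0 : ℝ) < N := by exact_mod_cast hN
  have hrpos : 0 < r N := by positivity
  have hr4 : r N ^ 4 = 2 * N := by
    rw [show r N ^ 4 = (r N ^ 2) ^ 2 by ring, Real.sq_sqrt (by positivity),
      Real.sq_sqrt (by positivity)]
  obtain ⟨J, m, hm, hNJ⟩ := exists_eq_blockStart_add N
  have hJ : (J : ℝ) ≤ r N ^ 2 := by
    refine le_of_sq_le_sq ?_ (by positivity)
    rw [← pow_mul, hr4]
    have : J ^ 2 ≤ 2 * N := by
      have := two_mul_blockStart J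
      nlinarith
    exact_mod_cast this
  have hJ3 : √((J : ℝ) ^ 3) ≤ r N ^ 3 := by
    refine Real.sqrt_le_iff.2 ⟨by positivity, ?_⟩
    calc (J : ℝ) ^ 3 ≤ (r N ^ 2) ^ 3 := by gcongr
      _ = (r N ^ 3) ^ 2 := by ring
  have hS : |∑ i ∈ Finset.range N, v i| ≤ (d + 1) * r N ^ 2 + K * r N ^ 3 := by
    rw [hNJ, Finset.sum_range_add, ← hNJ]
    have h2 := abs_sum_range_le_card (fun i => hv (blockStart J + i)) m
    have hmJ : (m : ℝ) ≤ J := by exact_mod_cast hm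
    have h3 : K * √((J : ℝ) ^ 3) ≤ K * r N ^ 3 := by gcongr
    have h4 : d * J ≤ d * r N ^ 2 := by gcongr
    linarith [abs_add_le (∑ i ∈ Finset.range (blockStart J), v i)
      (∑ i ∈ Finset.range m, v (blockStart J + i)), h J]
  rw [norm_div, Real.norm_eq_abs, Real.norm_of_nonneg hN'.le, div_le_iff₀ hN']
  refine hS.trans (le_of_eq ?_)
  rw [show (N : ℝ) = r N ^ 4 / 2 by rw [hr4]; ring]
  field_simp

lemma abs_sum_range_sub_le {f g : ℕ → ℝ} {d : ℕ} (n : ℕ) (hle : ∀ m, |f m - g m| ≤ 1)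
    (heq : ∀ m, m + d < n → f m = g m) :
    |∑ m ∈ Finset.range n, (f m - g m)| ≤ d := by
  have h0 : ∑ m ∈ Finset.range (n - d), (f m - g m) = 0 :=
    Finset.sum_eq_zero fun m hm => by
      rw [Finset.mem_range] at hm
      rw [heq m (by omega), sub_self]
  have hn : n = (n - d) + min n d := by omega
  rw [hn, Finset.sum_range_add, h0, zero_add]
  refine (abs_sum_range_le_card (fun m => hle (n - d + m)) _).trans ?_
  exact_mod_cast min_le_right n d

end TriangularBlocks

/-- The set whose indicator on the `j`-th block records the visits to `A` of the first `j + 1`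
points of the orbit of `x j`. -/
def orbitSet {X : Type*} (T : X → X) (A : Set X) (x : ℕ → X) : Set ℕ :=
  {n | ∃ j m, m ≤ j ∧ n = blockStart j + m ∧ T^[m] (x j) ∈ A}

lemma blockStart_add_mem_orbitSet {X : Type*} {T : X → X} {A : Set X} {x : ℕ → X} {j m : ℕ}
    (hm : m ≤ j) : blockStart j + m ∈ orbitSet T A x ↔ T^[m] (x j) ∈ A := by
  constructor
  · rintro ⟨j', m', hm', h, hA⟩
    obtain ⟨rfl, rfl⟩ := blockStart_add_inj hm hm' h
    exact hA
  · exact fun h => ⟨j, m, hm, rfl, h⟩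

theorem inverse_furstenberg_correspondence
    {X : Type} [MeasurableSpace X] (μ : Measure X) [IsProbabilityMeasure μ]
    (T : X → X) (hT : Measurable T) (hTμ : MeasurePreserving T μ μ)
    (A : Set X) (hA : MeasurableSet A) :
    ∃ E : Set ℕ, ∀ (k : ℕ), 1 ≤ k → ∀ n : Fin k → ℕ,
      Tendsto
        (fun N : ℕ =>
          (((Finset.range N).filter (fun m => ∀ i : Fin k, m + n i ∈ E)).card : ℝ) / N)
        atTop
        (nhds ((μ (⋂ i : Fin k, T^[n i] ⁻¹' A)).toReal)) := by
  let B : Finset ℕ → Set X := fun F => ⋂ n ∈ F, T^[n] ⁻¹' A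
  have hB : ∀ F, MeasurableSet (B F) := fun F =>
    Finset.measurableSet_biInter F fun n _ => hT.iterate n hA
  let V : ℕ → Finset ℕ → X → ℝ := fun j F x =>
    ∑ m ∈ Finset.range (j + 1), ((B F).indicator 1 (T^[m] x) - μ.real (B F))
  have hind : ∀ F, Measurable ((B F).indicator (1 : X → ℝ)) := fun F =>
    measurable_one.indicator (hB F)
  have hdiff : ∀ (p : Prop) [Decidable p] (F : Finset ℕ),
      |(if p then 1 else 0) - μ.real (B F)| ≤ 1 := by
    intro p _ F
    have h0 : 0 ≤ μ.real (B F) := measureReal_nonneg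
    have h1 : μ.real (B F) ≤ 1 := measureReal_le_one
    rw [abs_le]
    split_ifs <;> constructor <;> linarith
  have hterm : ∀ F m, Measurable fun x => (B F).indicator (1 : X → ℝ) (T^[m] x) - μ.real (B F) :=
    fun F m => ((hind F).comp (hT.iterate m)).sub_const _
  obtain ⟨x, hx⟩ := exists_seq_sum_sq_le μ (V := V) (b := fun j => (j : ℝ) + 1)
    (fun j F => Finset.measurable_fun_sum _ fun m _ => hterm F m)
    (fun j F x => by
      have := abs_sum_range_le_card (fun m => hdiff (T^[m] x ∈ B F) F) (j + 1)
      simpa [V, Set.indicator_apply] using this)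
    (fun j F => by
      have hi : ∀ m, Integrable (fun x => (B F).indicator (1 : X → ℝ) (T^[m] x)) μ := fun m =>
        (hTμ.iterate m).integrable_comp_of_integrable
          ((integrable_const (1 : ℝ)).indicator (hB F))
      have hi' : ∀ m, Integrable
          (fun x => (B F).indicator (1 : X → ℝ) (T^[m] x) - μ.real (B F)) μ := fun m =>
        (hi m).sub (integrable_const _)
      rw [integral_finsetSum _ fun m _ => hi' m]
      refine Finset.sum_eq_zero fun m _ => ?_
      rw [integral_sub (hi m) (integrable_const _),
        ← integral_map (hTμ.iterate m).aemeasurable (hind F).aestronglyMeasurable,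
        (hTμ.iterate m).map_eq, integral_indicator_one (hB F)]
      simp)
  refine ⟨orbitSet T A x, fun k _ n => ?_⟩
  set F : Finset ℕ := Finset.univ.image n with hF
  have hBF : (⋂ i : Fin k, T^[n i] ⁻¹' A) = B F := by
    ext y
    simp [B, hF]
  obtain ⟨d, hd⟩ : ∃ d, ∀ i, n i ≤ d :=
    ⟨Finset.univ.sup n, fun i => Finset.le_sup (Finset.mem_univ i)⟩
  obtain ⟨C, hC, hxC⟩ := hx F
  rw [hBF]
  let u : ℕ → ℝ := fun m => if ∀ i, m + n i ∈ orbitSet T A x then 1 else 0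
  have hblock : ∀ j m, m + d < j + 1 →
      u (blockStart j + m) = (B F).indicator 1 (T^[m] (x j)) := by
    intro j m hm
    have : (∀ i, blockStart j + m + n i ∈ orbitSet T A x) ↔ T^[m] (x j) ∈ B F := by
      rw [← hBF, Set.mem_iInter]
      refine forall_congr' fun i => ?_
      have := hd i
      rw [add_assoc, blockStart_add_mem_orbitSet (by omega), Set.mem_preimage,
        ← Function.iterate_add_apply, add_comm m]
    simp only [u, this, Set.indicator_apply, Pi.one_apply]
  have hdiff' : ∀ j m, |u (blockStart j + m) - (B F).indicator 1 (T^[m] (x j))| ≤ 1 := by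
    intro j m
    simp only [u, Set.indicator_apply, Pi.one_apply]
    split_ifs <;> simp
  have hsum : ∀ J : ℕ, |∑ m ∈ Finset.range (blockStart J), (u m - μ.real (B F))| ≤
      (d : ℝ) * J + √C * √((J : ℝ) ^ 3) := by
    intro J
    have hsplit : ∑ m ∈ Finset.range (blockStart J), (u m - μ.real (B F)) =
        (∑ j ∈ Finset.range J, ∑ m ∈ Finset.range (j + 1),
          (u (blockStart j + m) - (B F).indicator 1 (T^[m] (x j)))) +
        ∑ j ∈ Finset.range J, V j F (x j) := by
      rw [sum_range_blockStart, ← Finset.sum_add_distrib]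
      refine Finset.sum_congr rfl fun j _ => ?_
      rw [← Finset.sum_add_distrib]
      exact Finset.sum_congr rfl fun m _ => by ring
    rw [hsplit]
    refine (abs_add_le _ _).trans (add_le_add ?_ ?_)
    · refine (Finset.abs_sum_le_sum_abs _ _).trans ?_
      refine (Finset.sum_le_sum fun j _ =>
        abs_sum_range_sub_le (j + 1) (hdiff' j) (hblock j)).trans (le_of_eq ?_)
      simp [mul_comm]
    · rw [← Real.sqrt_mul hC]
      refine Real.abs_le_sqrt ((hxC J).trans ?_)
      gcongr
      calc ∑ j ∈ Finset.range J, ((j : ℝ) + 1) ^ 2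
          ≤ ∑ _j ∈ Finset.range J, (J : ℝ) ^ 2 := by
            refine Finset.sum_le_sum fun j hj => ?_
            have : (j : ℝ) + 1 ≤ J := by exact_mod_cast Finset.mem_range.1 hj
            gcongr
        _ = (J : ℝ) ^ 3 := by simp; ring
  have hlim := tendsto_sum_div_of_blockStart (v := fun m => u m - μ.real (B F))
    (fun m => hdiff (∀ i, m + n i ∈ orbitSet T A x) F) (Nat.cast_nonneg d)
    (Real.sqrt_nonneg C) hsum
  have hlim' := hlim.add_const (μ.real (B F))
  rw [zero_add] at hlim'
  refine hlim'.congr' ?_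
  filter_upwards [eventually_gt_atTop 0] with N hN
  have hN' : (N : ℝ) ≠ 0 := by positivity
  rw [Finset.sum_sub_distrib, Finset.sum_const, Finset.card_range, nsmul_eq_mul, sub_div,
    mul_div_cancel_left₀ _ hN', sub_add_cancel]
  simp [u]
end

section
/- Given any measure preserving system (X, μ, T) and any measurable set A ⊆ X, there exists a set E ⊆ ℕ such that for every n ∈ ℕ the limit d(E ∩ (E − n)) := lim_{N→∞} |(E ∩ (E − n)) ∩ {0, 1, …, N−1}| / N exists and equals μ(A ∩ T^{−n}A); in particular (taking n = 0) the density d(E) exists and equals μ(A). -/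
open MeasureTheory Filter
open scoped Classical

/-- Sequential choice of points: given centred bounded functions `Z k n`, vanishing for
`2 * k + 1 ≤ n`, the points `x k` can be chosen one after the other so that the partial sums of
`Z k n (x k)` grow no faster than for independent random variables, for all `n` at once. -/
theorem exists_seq_sq_sum_le
    {X : Type*} [MeasurableSpace X] (μ : Measure X) [IsProbabilityMeasure μ]
    (Z : ℕ → ℕ → X → ℝ) (hint : ∀ k n, Integrable (Z k n) μ)
    (hzero : ∀ k n, ∫ x, Z k n x ∂μ = 0)
    (hbound : ∀ k n x, |Z k n x| ≤ 2 * k + 1)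
    (hvanish : ∀ k n x, 2 * k + 1 ≤ n → Z k n x = 0) :
    ∃ x : ℕ → X, ∀ n K : ℕ,
      (∑ k ∈ Finset.range K, Z k n (x k)) ^ 2 ≤ 2 ^ (n + 2) * (K : ℝ) ^ 3 := by
  have hpick : ∀ (k : ℕ) (s : ℕ → ℝ), ∃ x : X,
      ∑ n ∈ Finset.range (2 * k + 1), (1 / 2 : ℝ) ^ n * s n * Z k n x ≤ 0 := by
    intro k s
    have hi : Integrable
        (fun x => ∑ n ∈ Finset.range (2 * k + 1), (1 / 2 : ℝ) ^ n * s n * Z k n x) μ :=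
      integrable_finsetSum _ fun n _ => (hint k n).const_mul _
    obtain ⟨x, hx⟩ := exists_le_integral hi
    refine ⟨x, hx.trans_eq ?_⟩
    rw [integral_finsetSum _ fun n _ => (hint k n).const_mul _]
    simp [integral_const_mul, hzero]
  choose pick hpick using hpick
  let s : ℕ → ℕ → ℝ := fun k => Nat.rec (fun _ => 0) (fun k s n => s n + Z k n (pick k s)) k
  have hs : ∀ n K, ∑ k ∈ Finset.range K, Z k n (pick k (s k)) = s K n := by
    intro n K
    induction K with
    | zero => rfl
    | succ K ih => rw [Finset.sum_range_succ, ih]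
  have hcross : ∀ k M, 2 * k + 1 ≤ M →
      ∑ n ∈ Finset.range M, (1 / 2 : ℝ) ^ n * s k n * Z k n (pick k (s k)) ≤ 0 := by
    intro k M hM
    rw [← Finset.sum_subset (Finset.range_mono hM)]
    · exact hpick k (s k)
    · intro n _ hn
      rw [hvanish k n _ (by simpa using hn), mul_zero]
  have henergy : ∀ M K, 2 * K ≤ M + 1 →
      ∑ n ∈ Finset.range M, (1 / 2 : ℝ) ^ n * s K n ^ 2 ≤ 4 * (K : ℝ) ^ 3 := by
    intro M K
    induction K with
    | zero => intro _; simp [s]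
    | succ K ih =>
      intro hM
      have hZ : ∑ n ∈ Finset.range M, (1 / 2 : ℝ) ^ n * Z K n (pick K (s K)) ^ 2
          ≤ 2 * (2 * K + 1) ^ 2 := by
        calc _ ≤ ∑ n ∈ Finset.range M, (1 / 2 : ℝ) ^ n * (2 * K + 1) ^ 2 := by
              refine Finset.sum_le_sum fun n _ => mul_le_mul_of_nonneg_left ?_ (by positivity)
              exact sq_le_sq' (neg_le_of_abs_le (hbound ..)) (le_of_abs_le (hbound ..))
          _ ≤ _ := by
              rw [← Finset.sum_mul]
              gcongr
              exact sum_geometric_two_le M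
      have hexpand : ∑ n ∈ Finset.range M, (1 / 2 : ℝ) ^ n * s (K + 1) n ^ 2
          = ∑ n ∈ Finset.range M, (1 / 2 : ℝ) ^ n * s K n ^ 2
            + 2 * ∑ n ∈ Finset.range M, (1 / 2 : ℝ) ^ n * s K n * Z K n (pick K (s K))
            + ∑ n ∈ Finset.range M, (1 / 2 : ℝ) ^ n * Z K n (pick K (s K)) ^ 2 := by
        rw [Finset.mul_sum, ← Finset.sum_add_distrib, ← Finset.sum_add_distrib]
        refine Finset.sum_congr rfl fun n _ => ?_
        have : s (K + 1) n = s K n + Z K n (pick K (s K)) := rfl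
        rw [this]
        ring
      have h1 := hcross K M (by omega)
      have h2 := ih (by omega)
      have hK : (0 : ℝ) ≤ K := K.cast_nonneg
      rw [hexpand]
      push_cast
      nlinarith [pow_nonneg hK 2]
  refine ⟨fun k => pick k (s k), fun n K => ?_⟩
  rw [hs]
  have hsingle : (1 / 2 : ℝ) ^ n * s K n ^ 2 ≤ 4 * (K : ℝ) ^ 3 :=
    (Finset.single_le_sum (f := fun n => (1 / 2 : ℝ) ^ n * s K n ^ 2)
      (fun i _ => by positivity) (Finset.mem_range.2 (by omega : n < n + 1 + 2 * K))).trans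
      (henergy (n + 1 + 2 * K) K (by omega))
  have h2 : (2 : ℝ) ^ n * (1 / 2) ^ n = 1 := by rw [← mul_pow]; norm_num
  calc s K n ^ 2 = 2 ^ n * ((1 / 2 : ℝ) ^ n * s K n ^ 2) := by rw [← mul_assoc, h2, one_mul]
    _ ≤ 2 ^ n * (4 * (K : ℝ) ^ 3) := by gcongr
    _ = _ := by ring

/-- If the sums of a bounded sequence over the first `K` blocks `[k ^ 2, (k + 1) ^ 2)` are
`O(K ^ (3 / 2))` up to an error `O(K)`, then its averages tend to zero. -/
theorem tendsto_average_zero_of_sq_blocks (a : ℕ → ℝ) (ha : ∀ m, |a m| ≤ 1)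
    (S : ℕ → ℝ) (C B : ℝ) (hS : ∀ K, S K ^ 2 ≤ C * (K : ℝ) ^ 3)
    (hD : ∀ K, |∑ m ∈ Finset.range (K ^ 2), a m - S K| ≤ B * K) :
    Tendsto (fun N : ℕ => (∑ m ∈ Finset.range N, a m) / N) atTop (nhds 0) := by
  have hsqrt : Tendsto (fun N : ℕ => (Nat.sqrt N : ℝ)) atTop atTop := by
    refine tendsto_natCast_atTop_atTop.comp (tendsto_atTop.2 fun b => ?_)
    filter_upwards [eventually_ge_atTop (b * b)] with N hN using Nat.le_sqrt.2 hN
  have hlim : Tendsto (fun N : ℕ => √(C / (Nat.sqrt N : ℝ)) + (B + 2) / (Nat.sqrt N : ℝ))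
      atTop (nhds 0) := by
    have h1 : Tendsto (fun N : ℕ => √(C / (Nat.sqrt N : ℝ))) atTop (nhds √0) :=
      (Real.continuous_sqrt.tendsto 0).comp (hsqrt.const_div_atTop C)
    simpa using h1.add (hsqrt.const_div_atTop (B + 2))
  refine squeeze_zero_norm' ?_ hlim
  filter_upwards [eventually_ge_atTop 1] with N hN
  set K := Nat.sqrt N with hK
  have hK0 : 0 < K := Nat.sqrt_pos.2 hN
  have hKR : (0 : ℝ) < K := by exact_mod_cast hK0
  have hKN : K ^ 2 ≤ N := by rw [pow_two]; exact Nat.sqrt_le N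
  have hNK : N ≤ K ^ 2 + 2 * K := by
    have := Nat.sqrt_le_add N
    rw [← hK] at this
    rw [pow_two]; omega
  have hKNR : (K : ℝ) ^ 2 ≤ N := by exact_mod_cast hKN
  have hSK : |S K| ≤ √(C / K) * (K : ℝ) ^ 2 := by
    refine Real.abs_le_sqrt (hS K) |>.trans_eq ?_
    rw [show C * (K : ℝ) ^ 3 = C / K * ((K : ℝ) ^ 2) ^ 2 by field_simp,
      Real.sqrt_mul' _ (by positivity), Real.sqrt_sq (by positivity)]
  have htail : |∑ m ∈ Finset.Ico (K ^ 2) N, a m| ≤ 2 * K := by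
    calc _ ≤ ∑ m ∈ Finset.Ico (K ^ 2) N, |a m| := Finset.abs_sum_le_sum_abs ..
      _ ≤ ∑ m ∈ Finset.Ico (K ^ 2) N, (1 : ℝ) := Finset.sum_le_sum fun m _ => ha m
      _ = ((N - K ^ 2 : ℕ) : ℝ) := by simp
      _ ≤ 2 * K := by exact_mod_cast (by omega : N - K ^ 2 ≤ 2 * K)
  have htotal : |∑ m ∈ Finset.range N, a m| ≤ √(C / K) * (K : ℝ) ^ 2 + (B + 2) * K := by
    rw [← Finset.sum_range_add_sum_Ico a hKN]
    have h1 := abs_le.1 (hD K)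
    have h2 := abs_le.1 hSK
    have h3 := abs_le.1 htail
    exact abs_le.2 ⟨by linarith, by linarith⟩
  rw [Real.norm_eq_abs, abs_div, Nat.abs_cast]
  calc _ ≤ |∑ m ∈ Finset.range N, a m| / (K : ℝ) ^ 2 := by gcongr
    _ ≤ (√(C / K) * (K : ℝ) ^ 2 + (B + 2) * K) / (K : ℝ) ^ 2 := by gcongr
    _ = _ := by field_simp

/-- Given any measure preserving system `(X, μ, T)` and measurable `A ⊆ X`, there is `E ⊆ ℕ`
such that for every `n ∈ ℕ` the density of `E ∩ (E - n)` along `{0, …, N-1}` exists and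
equals `μ(A ∩ T^{-n}A)` (in particular, for `n = 0`, `d(E)` exists and equals `μ(A)`). -/
theorem inverse_correspondence_single
    {X : Type} [MeasurableSpace X] (μ : Measure X) [IsProbabilityMeasure μ]
    (T : X → X) (hT : Measurable T) (hTμ : MeasurePreserving T μ μ)
    (A : Set X) (hA : MeasurableSet A) :
    ∃ E : Set ℕ, ∀ n : ℕ,
      Tendsto
        (fun N : ℕ =>
          (((Finset.range N).filter (fun m => m ∈ E ∧ m + n ∈ E)).card : ℝ) / N)
        atTop
        (nhds ((μ (A ∩ T^[n] ⁻¹' A)).toReal)) := by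
  set c : ℕ → ℝ := fun n => (μ (A ∩ T^[n] ⁻¹' A)).toReal with hc
  have hc0 : ∀ n, 0 ≤ c n := fun n => ENNReal.toReal_nonneg
  have hc1 : ∀ n, c n ≤ 1 := fun n => measureReal_le_one
  have hmeas : ∀ n, MeasurableSet (A ∩ T^[n] ⁻¹' A) := fun n => hA.inter (hT.iterate n hA)
  let F : ℕ → X → ℝ := fun n x => (A ∩ T^[n] ⁻¹' A).indicator (fun _ => (1 : ℝ)) x - c n
  have hFint : ∀ n, Integrable (F n) μ := fun n =>
    ((integrable_const (1 : ℝ)).indicator (hmeas n)).sub (integrable_const _)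
  have hFzero : ∀ n, ∫ x, F n x ∂μ = 0 := by
    intro n
    rw [integral_sub ((integrable_const (1 : ℝ)).indicator (hmeas n)) (integrable_const _),
      integral_indicator_const _ (hmeas n)]
    simp [hc, measureReal_def]
  have hFbound : ∀ n x, |F n x| ≤ 1 := by
    intro n x
    have h0 := hc0 n
    have h1 := hc1 n
    simp only [F, Set.indicator_apply]
    split_ifs <;> exact abs_le.2 ⟨by linarith, by linarith⟩
  have hFcomp : ∀ n j, Integrable (fun x => F n (T^[j] x)) μ := fun n j =>
    (hTμ.iterate j).integrable_comp_of_integrable (hFint n)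
  have hFcompzero : ∀ n j, ∫ x, F n (T^[j] x) ∂μ = 0 := by
    intro n j
    rw [← hFzero n]
    conv_rhs => rw [← (hTμ.iterate j).map_eq]
    refine (integral_map (hTμ.iterate j).aemeasurable ?_).symm
    rw [(hTμ.iterate j).map_eq]
    exact (hFint n).aestronglyMeasurable
  obtain ⟨x, hx⟩ := exists_seq_sq_sum_le μ
    (fun k n x => ∑ j ∈ Finset.range (2 * k + 1 - n), F n (T^[j] x))
    (fun k n => integrable_finsetSum _ fun j _ => hFcomp n j)
    (fun k n => by
      rw [integral_finsetSum _ fun j _ => hFcomp n j]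
      simp [hFcompzero])
    (fun k n x => by
      calc _ ≤ ∑ j ∈ Finset.range (2 * k + 1 - n), |F n (T^[j] x)| :=
            Finset.abs_sum_le_sum_abs ..
        _ ≤ ∑ j ∈ Finset.range (2 * k + 1 - n), (1 : ℝ) :=
            Finset.sum_le_sum fun j _ => hFbound ..
        _ = ((2 * k + 1 - n : ℕ) : ℝ) := by simp
        _ ≤ ((2 * k + 1 : ℕ) : ℝ) := by exact_mod_cast Nat.sub_le ..
        _ = _ := by push_cast; ring)
    (fun k n x h => by simp [Nat.sub_eq_zero_of_le h])
  let E : Set ℕ := {m | T^[m - Nat.sqrt m ^ 2] (x (Nat.sqrt m)) ∈ A}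
  have hE : ∀ k j, j < 2 * k + 1 → (k ^ 2 + j ∈ E ↔ T^[j] (x k) ∈ A) := by
    intro k j hj
    have : Nat.sqrt (k ^ 2 + j) = k := Nat.sqrt_add_eq' k (by omega)
    simp only [E, Set.mem_ofPred_eq, this, Nat.add_sub_cancel_left]
  refine ⟨E, fun n => ?_⟩
  let a : ℕ → ℝ := fun m => (if m ∈ E ∧ m + n ∈ E then 1 else 0) - c n
  have ha : ∀ m, |a m| ≤ 1 := by
    intro m
    have h0 := hc0 n
    have h1 := hc1 n
    simp only [a]
    split_ifs <;> exact abs_le.2 ⟨by linarith, by linarith⟩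
  have hblock : ∀ k, |∑ j ∈ Finset.range (2 * k + 1), a (k ^ 2 + j)
      - ∑ j ∈ Finset.range (2 * k + 1 - n), F n (T^[j] (x k))| ≤ n := by
    intro k
    have hcongr : ∑ j ∈ Finset.range (2 * k + 1 - n), F n (T^[j] (x k))
        = ∑ j ∈ Finset.range (2 * k + 1 - n), a (k ^ 2 + j) := by
      refine Finset.sum_congr rfl fun j hj => ?_
      have hj' : j + n < 2 * k + 1 := by
        have := Finset.mem_range.1 hj
        omega
      simp only [F, a, Set.indicator_apply, add_assoc, hE k j (by omega), hE k (j + n) hj',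
        Set.mem_inter_iff, Set.mem_preimage, ← Function.iterate_add_apply, add_comm n j]
    rw [hcongr, ← Finset.sum_range_add_sum_Ico _ (Nat.sub_le (2 * k + 1) n), add_sub_cancel_left]
    calc _ ≤ ∑ j ∈ Finset.Ico (2 * k + 1 - n) (2 * k + 1), |a (k ^ 2 + j)| :=
          Finset.abs_sum_le_sum_abs ..
      _ ≤ ∑ j ∈ Finset.Ico (2 * k + 1 - n) (2 * k + 1), (1 : ℝ) :=
          Finset.sum_le_sum fun j _ => ha _
      _ = ((2 * k + 1 - (2 * k + 1 - n) : ℕ) : ℝ) := by simp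
      _ ≤ n := by exact_mod_cast (by omega)
  have havg := tendsto_average_zero_of_sq_blocks a ha _ _ n (hx n) fun K => by
    induction K with
    | zero => simp
    | succ K ih =>
      rw [show (K + 1) ^ 2 = K ^ 2 + (2 * K + 1) by ring, Finset.sum_range_add,
        Finset.sum_range_succ (n := K), add_sub_add_comm]
      refine (abs_add_le _ _).trans ((add_le_add ih (hblock K)).trans_eq ?_)
      push_cast
      ring
  have hfinal := havg.add_const (c n)
  rw [zero_add] at hfinal
  refine hfinal.congr' ?_
  filter_upwards [eventually_ge_atTop 1] with N hN
  have hN0 : (N : ℝ) ≠ 0 := by positivity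
  simp only [a, Finset.sum_sub_distrib, Finset.sum_boole, Finset.sum_const, Finset.card_range,
    nsmul_eq_mul]
  field_simp
  ring
end

section
/- A set R ⊆ ℕ is a set of nice recurrence if and only if it is ({0, …, N−1})-nicely intersective, i.e. nicely intersective with respect to the Følner sequence F_N = {0, 1, …, N−1}. -/
open MeasureTheory Filter
open scoped Classical symmDiff

/-- The upper density of `E ⊆ ℕ` with respect to a sequence `F` of finite subsets of `ℕ`. -/
noncomputable def upperDensity (F : ℕ → Finset ℕ) (E : Set ℕ) : ℝ :=
  limsup (fun N : ℕ => (((F N).filter (· ∈ E)).card : ℝ) / (F N).card) atTop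

/-- `F` is a Følner sequence in `ℕ`: `|F_N ∆ (F_N + t)| / |F_N| → 0` for every `t`. -/
def IsFolner (F : ℕ → Finset ℕ) : Prop :=
  ∀ t : ℕ,
    Tendsto (fun N : ℕ => (((F N) ∆ ((F N).image (· + t))).card : ℝ) / (F N).card)
      atTop (nhds 0)

/-- `R ⊆ ℕ` is a set of nice recurrence: for every measure preserving system `(X, μ, T)`,
every measurable `A ⊆ X` and every `ε > 0` there is a nonzero `r ∈ R` with
`μ(A ∩ T^{-r}A) > μ(A)² - ε`. -/
def IsNiceRecurrenceSet (R : Set ℕ) : Prop :=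
  ∀ (X : Type) (_ : MeasurableSpace X) (μ : Measure X) (T : X → X),
    IsProbabilityMeasure μ → Measurable T → MeasurePreserving T μ μ →
    ∀ A : Set X, MeasurableSet A → ∀ ε : ℝ, 0 < ε →
      ∃ r ∈ R, r ≠ 0 ∧ (μ (A ∩ T^[r] ⁻¹' A)).toReal > (μ A).toReal ^ 2 - ε

/-- `R ⊆ ℕ` is a set of recurrence: for every measure preserving system `(X, μ, T)` and
every measurable `A ⊆ X` with `μ(A) > 0` there is a nonzero `r ∈ R` with
`μ(A ∩ T^{-r}A) > 0`. -/
def IsRecurrenceSet (R : Set ℕ) : Prop :=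
  ∀ (X : Type) (_ : MeasurableSpace X) (μ : Measure X) (T : X → X),
    IsProbabilityMeasure μ → Measurable T → MeasurePreserving T μ μ →
    ∀ A : Set X, MeasurableSet A → 0 < μ A →
      ∃ r ∈ R, r ≠ 0 ∧ 0 < μ (A ∩ T^[r] ⁻¹' A)

/-- `R` is `(F_N)`-nicely intersective: for every `E ⊆ ℕ` and `ε > 0` there is a nonzero
`r ∈ R` with `d̄_F(E ∩ (E - r)) > d̄_F(E)² - ε`. -/
def NicelyIntersective (F : ℕ → Finset ℕ) (R : Set ℕ) : Prop :=
  ∀ E : Set ℕ, ∀ ε : ℝ, 0 < ε →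
    ∃ r ∈ R, r ≠ 0 ∧
      upperDensity F (E ∩ {m : ℕ | m + r ∈ E}) > (upperDensity F E) ^ 2 - ε

/-- `R` is `(F_N)`-intersective: every `E ⊆ ℕ` of positive upper density contains two
elements differing by a nonzero element of `R`. -/
def Intersective (F : ℕ → Finset ℕ) (R : Set ℕ) : Prop :=
  ∀ E : Set ℕ, 0 < upperDensity F E →
    ∃ r ∈ R, r ≠ 0 ∧ (E ∩ {m : ℕ | m + r ∈ E}).Nonempty

theorem upperDensity_range_eq (E : Set ℕ) :
    upperDensity (fun N => Finset.range N) E =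
      limsup (fun N : ℕ => (∑ n ∈ Finset.range N, E.indicator (1 : ℕ → ℝ) n) / N) atTop := by
  simp [upperDensity, Set.indicator_apply, Finset.sum_boole]

theorem indicator_one_mem_Icc {Y : Type*} (B : Set Y) (y : Y) :
    B.indicator (1 : Y → ℝ) y ∈ Set.Icc (0 : ℝ) 1 :=
  ⟨Set.indicator_nonneg (fun _ _ => zero_le_one) y,
    Set.indicator_le_self' (fun _ _ => zero_le_one) y⟩

theorem abs_indicator_one_sub_le {Y : Type*} (B : Set Y) (y : Y) {c : ℝ}
    (hc : c ∈ Set.Icc (0 : ℝ) 1) : |B.indicator (1 : Y → ℝ) y - c| ≤ 1 := by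
  obtain ⟨h0, h1⟩ := indicator_one_mem_Icc B y
  rw [abs_le]
  constructor <;> linarith [hc.1, hc.2]

theorem average_mem_Icc (E : Set ℕ) (N : ℕ) :
    (∑ n ∈ Finset.range N, E.indicator (1 : ℕ → ℝ) n) / N ∈ Set.Icc (0 : ℝ) 1 := by
  have h1 := Finset.sum_le_card_nsmul (Finset.range N) _ 1 fun n _ =>
    (indicator_one_mem_Icc E n).2
  exact ⟨div_nonneg (Finset.sum_nonneg fun n _ => (indicator_one_mem_Icc E n).1)
    (Nat.cast_nonneg N), div_le_one_of_le₀ (by simpa using h1) (Nat.cast_nonneg N)⟩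

/-- The left shift on the full shift `{0, 1}^ℕ`. -/
def leftShift (x : ℕ → Bool) : ℕ → Bool := fun n => x (n + 1)

theorem leftShift_iterate (r : ℕ) (x : ℕ → Bool) (n : ℕ) : leftShift^[r] x n = x (n + r) := by
  induction r generalizing x n with
  | zero => rfl
  | succ r ih =>
    rw [Function.iterate_succ_apply, ih]
    simp [leftShift, Nat.add_assoc]

theorem continuous_leftShift : Continuous leftShift := by
  unfold leftShift
  fun_prop

/-- The uniform probability measure on the orbit segment `x, T x, …, T^N x` of the shift. -/
noncomputable def empiricalMeasure (x : ℕ → Bool) (N : ℕ) : Measure (ℕ → Bool) :=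
  ENNReal.ofReal (((N + 1 : ℕ) : ℝ)⁻¹) •
    ∑ n ∈ Finset.range (N + 1), Measure.dirac (leftShift^[n] x)

theorem integral_empiricalMeasure (x : ℕ → Bool) (N : ℕ) (f : (ℕ → Bool) → ℝ) :
    ∫ y, f y ∂(empiricalMeasure x N) =
      (∑ n ∈ Finset.range (N + 1), f (leftShift^[n] x)) / (N + 1 : ℕ) := by
  rw [empiricalMeasure, integral_smul_measure, ENNReal.toReal_ofReal (by positivity),
    integral_finsetSum_measure]
  · simp only [integral_dirac, smul_eq_mul]
    ring
  · intro n _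
    exact integrable_dirac (by simp)

instance isProbabilityMeasure_empiricalMeasure (x : ℕ → Bool) (N : ℕ) :
    IsProbabilityMeasure (empiricalMeasure x N) := by
  constructor
  have h : (0 : ℝ) < ((N + 1 : ℕ) : ℝ) := by positivity
  simp only [empiricalMeasure, Measure.smul_apply, Measure.finsetSum_apply, measure_univ,
    Finset.sum_const, Finset.card_range, smul_eq_mul, nsmul_eq_mul, mul_one]
  rw [ENNReal.ofReal_inv_of_pos h, ENNReal.ofReal_natCast]
  exact ENNReal.inv_mul_cancel (by simp) (ENNReal.natCast_ne_top _)

/-- A weak limit of the empirical measures of a point along a filter is invariant under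
the shift. -/
theorem measurePreserving_leftShift_of_tendsto {ι : Type*} {l : Filter ι} [l.NeBot]
    (x : ℕ → Bool) (ν : Measure (ℕ → Bool)) [IsProbabilityMeasure ν] (N : ι → ℕ)
    (hN : Tendsto N l atTop)
    (hν : ∀ f : BoundedContinuousFunction (ℕ → Bool) ℝ,
      Tendsto (fun i => ∫ y, f y ∂(empiricalMeasure x (N i))) l (nhds (∫ y, f y ∂ν))) :
    MeasurePreserving leftShift ν ν := by
  refine ⟨continuous_leftShift.measurable, ?_⟩
  have : IsProbabilityMeasure (ν.map leftShift) :=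
    Measure.isProbabilityMeasure_map continuous_leftShift.measurable.aemeasurable
  refine ext_of_forall_integral_eq_of_IsFiniteMeasure fun f => ?_
  rw [integral_map continuous_leftShift.measurable.aemeasurable
    f.continuous.aestronglyMeasurable]
  have h1 := hν (f.compContinuous ⟨leftShift, continuous_leftShift⟩)
  refine tendsto_nhds_unique h1 ?_
  have h2 : Tendsto (fun i => (f (leftShift^[N i + 1] x) - f x) / ((N i + 1 : ℕ) : ℝ)) l
      (nhds 0) := by
    have hd : Tendsto (fun i => (2 * ‖f‖) / ((N i + 1 : ℕ) : ℝ)) l (nhds 0) :=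
      Tendsto.div_atTop tendsto_const_nhds
        ((tendsto_natCast_atTop_atTop.comp (tendsto_add_atTop_nat 1)).comp hN)
    refine squeeze_zero_norm (fun i => ?_) hd
    rw [norm_div, Real.norm_natCast]
    gcongr
    rw [← dist_eq_norm]
    exact f.dist_le_two_norm _ _
  have h3 := (hν f).add h2
  rw [add_zero] at h3
  refine h3.congr fun i => ?_
  simp only [integral_empiricalMeasure, BoundedContinuousFunction.compContinuous_apply,
    ContinuousMap.coe_mk, ← Function.iterate_succ_apply' leftShift]
  rw [← add_div]
  congr 1
  have := Finset.sum_range_succ' (fun n => f (leftShift^[n] x)) (N i + 1)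
  rw [Finset.sum_range_succ] at this
  simp only [Function.iterate_zero, id] at this
  linarith

/-- **Furstenberg's correspondence principle** for upper density. -/
theorem exists_measurePreserving_le_upperDensity (E : Set ℕ) :
    ∃ (ν : Measure (ℕ → Bool)) (_ : IsProbabilityMeasure ν) (A : Set (ℕ → Bool)),
      MeasurePreserving leftShift ν ν ∧ MeasurableSet A ∧
      ν.real A = upperDensity (fun N => Finset.range N) E ∧
      ∀ r, ν.real (A ∩ leftShift^[r] ⁻¹' A) ≤
        upperDensity (fun N => Finset.range N) (E ∩ {m | m + r ∈ E}) := by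
  set u : Set ℕ → ℕ → ℝ :=
    fun D N => (∑ n ∈ Finset.range N, D.indicator (1 : ℕ → ℝ) n) / N with hu
  have hbdd (D : Set ℕ) (l : Filter ℕ) : IsBoundedUnder (· ≤ ·) l (u D) :=
    isBoundedUnder_of ⟨1, fun N => (average_mem_Icc D N).2⟩
  have hcobdd (D : Set ℕ) (l : Filter ℕ) [l.NeBot] : IsCoboundedUnder (· ≤ ·) l (u D) :=
    (isBoundedUnder_of ⟨0, fun N => (average_mem_Icc D N).1⟩ :
      IsBoundedUnder (· ≥ ·) l (u D)).isCoboundedUnder_le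
  obtain ⟨N, hN, hlim⟩ : ∃ N : ℕ → ℕ, Tendsto N atTop atTop ∧
      Tendsto (fun k => u E (N k + 1)) atTop
        (nhds (upperDensity (fun N => Finset.range N) E)) := by
    have hb : IsBoundedUnder (· ≤ ·) atTop (fun k => u E (k + 1)) :=
      isBoundedUnder_of ⟨1, fun N => (average_mem_Icc E (N + 1)).2⟩
    have hc : IsCoboundedUnder (· ≤ ·) atTop (fun k => u E (k + 1)) :=
      (isBoundedUnder_of ⟨0, fun N => (average_mem_Icc E (N + 1)).1⟩ :
        IsBoundedUnder (· ≥ ·) atTop (fun k => u E (k + 1))).isCoboundedUnder_le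
    obtain ⟨N, h2, h1⟩ := exists_seq_tendsto_limsup (f := atTop) hc hb
    refine ⟨N, h1, ?_⟩
    rw [limsup_nat_add (u E) 1] at h2
    rw [upperDensity_range_eq]
    exact h2
  set x : ℕ → Bool := fun n => decide (n ∈ E) with hx
  let m : ℕ → ProbabilityMeasure (ℕ → Bool) := fun k => ⟨empiricalMeasure x (N k), inferInstance⟩
  obtain ⟨V, hV⟩ := Ultrafilter.exists_le (atTop : Filter ℕ)
  obtain ⟨ν, -, hν⟩ := isCompact_univ.ultrafilter_le_nhds (V.map m) (by simp)
  have hν' : Tendsto m V (nhds ν) := hν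
  rw [ProbabilityMeasure.tendsto_iff_forall_integral_tendsto] at hν'
  set A : Set (ℕ → Bool) := {y | y 0 = true} with hA
  have hAr (r : ℕ) : IsClopen (A ∩ leftShift^[r] ⁻¹' A) := by
    have h0 : IsClopen A := (isClopen_discrete ({true} : Set Bool)).preimage (continuous_apply 0)
    exact h0.inter (h0.preimage (continuous_leftShift.iterate r))
  have hlimr (r : ℕ) : Tendsto (fun k => u (E ∩ {m | m + r ∈ E}) (N k + 1)) V
      (nhds ((ν : Measure (ℕ → Bool)).real (A ∩ leftShift^[r] ⁻¹' A))) := by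
    let f : BoundedContinuousFunction (ℕ → Bool) ℝ :=
      BoundedContinuousFunction.mkOfCompact
        ⟨(A ∩ leftShift^[r] ⁻¹' A).indicator 1,
          (hAr r).continuous_indicator continuous_one⟩
    have := hν' f
    have hf : (f : (ℕ → Bool) → ℝ) = (A ∩ leftShift^[r] ⁻¹' A).indicator 1 := rfl
    rw [hf, integral_indicator_one (hAr r).isOpen.measurableSet] at this
    refine this.congr fun k => ?_
    change ∫ y, _ ∂(empiricalMeasure x (N k)) = _
    rw [integral_empiricalMeasure]
    simp only [hu]
    congr 1
    refine Finset.sum_congr rfl fun n _ => ?_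
    have hmem : leftShift^[n] x ∈ A ∩ leftShift^[r] ⁻¹' A ↔ n ∈ E ∩ {m | m + r ∈ E} := by
      simp [hA, hx, leftShift_iterate, Nat.add_comm r n]
    simp only [Set.indicator_apply, hmem, Pi.one_apply]
  have hN1 : Tendsto (fun k => N k + 1) V atTop :=
    ((tendsto_add_atTop_nat 1).comp hN).mono_left hV
  refine ⟨ν, inferInstance, A, ?_, (by simpa using (hAr 0).isOpen.measurableSet), ?_, fun r => ?_⟩
  · exact measurePreserving_leftShift_of_tendsto x ν N (hN.mono_left hV) hν'
  · have h0 := hlimr 0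
    simp only [Function.iterate_zero, Set.preimage_id, Set.inter_self, add_zero,
      Set.ofPred_mem_eq] at h0
    exact tendsto_nhds_unique h0 (hlim.mono_left hV)
  · rw [upperDensity_range_eq, ← (hlimr r).limsup_eq]
    exact limsup_le_limsup_of_le (u := u (E ∩ {m | m + r ∈ E})) hN1 (hcobdd _ _) (hbdd _ _)

/-- The correlation of a measurable set along an orbit, minus its mean, summed over an orbit
segment of length `2 * k + 1`. -/
noncomputable def blockDiscrepancy {X : Type*} [MeasurableSpace X] (μ : Measure X) (T : X → X)
    (A : Set X) (k r : ℕ) (x : X) : ℝ :=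
  ∑ j ∈ Finset.range (2 * k + 1),
    ((A ∩ T^[r] ⁻¹' A).indicator (1 : X → ℝ) (T^[j] x) - μ.real (A ∩ T^[r] ⁻¹' A))

/-- The set whose indicator on each block `[k², (k + 1)²)` is the itinerary of `x k`. -/
def blockItinerary {X : Type*} (T : X → X) (A : Set X) (x : ℕ → X) : Set ℕ :=
  {n | T^[n - n.sqrt ^ 2] (x n.sqrt) ∈ A}

theorem mem_blockItinerary_iff {X : Type*} {T : X → X} {A : Set X} (x : ℕ → X) {k j : ℕ}
    (hj : j < 2 * k + 1) :
    k ^ 2 + j ∈ blockItinerary T A x ↔ T^[j] (x k) ∈ A := by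
  have : (k ^ 2 + j).sqrt = k := by
    rw [pow_two]
    exact Nat.sqrt_add_eq k (by omega)
  simp [blockItinerary, this]

theorem sum_range_sq_eq_sum_blocks (g : ℕ → ℝ) (K : ℕ) :
    ∑ n ∈ Finset.range (K ^ 2), g n =
      ∑ k ∈ Finset.range K, ∑ j ∈ Finset.range (2 * k + 1), g (k ^ 2 + j) := by
  induction K with
  | zero => simp
  | succ K ih =>
    rw [Finset.sum_range_succ, ← ih, show (K + 1) ^ 2 = K ^ 2 + (2 * K + 1) by ring,
      Finset.sum_range_add]

/-- If the sums along squares of a bounded sequence are `o(K²)`, its averages tend to zero. -/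
theorem tendsto_average_of_tendsto_average_sq {g : ℕ → ℝ} (hg : ∀ n, |g n| ≤ 1)
    (h : Tendsto (fun K : ℕ => (∑ n ∈ Finset.range (K ^ 2), g n) / (K : ℝ) ^ 2) atTop (nhds 0)) :
    Tendsto (fun N : ℕ => (∑ n ∈ Finset.range N, g n) / (N : ℝ)) atTop (nhds 0) := by
  have hsqrt : Tendsto Nat.sqrt atTop atTop := by
    refine tendsto_atTop_atTop.2 fun b => ⟨b ^ 2, fun a ha => ?_⟩
    exact Nat.le_sqrt'.2 ha
  have h1 : Tendsto (fun K : ℕ => (2 : ℝ) / K) atTop (nhds 0) :=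
    tendsto_const_nhds.div_atTop tendsto_natCast_atTop_atTop
  have h2 := (h.abs.add (by simpa using h1)).comp hsqrt
  rw [abs_zero, add_zero] at h2
  refine squeeze_zero_norm' ?_ h2
  filter_upwards [eventually_ge_atTop 1] with N hN
  set K := N.sqrt with hK
  have hK1 : 1 ≤ K := Nat.le_sqrt'.2 (by simpa using hN)
  have hKN : K ^ 2 ≤ N := Nat.sqrt_le' N
  have hNK : N < (K + 1) ^ 2 := Nat.lt_succ_sqrt' N
  have hKpos : (0 : ℝ) < K := by exact_mod_cast hK1
  have hKN' : (K : ℝ) ^ 2 ≤ N := by exact_mod_cast hKN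
  have htail : |∑ n ∈ Finset.range (N - K ^ 2), g (K ^ 2 + n)| ≤ 2 * K := by
    refine (Finset.abs_sum_le_sum_abs _ _).trans
      ((Finset.sum_le_card_nsmul _ _ 1 fun n _ => hg _).trans ?_)
    have : N - K ^ 2 ≤ 2 * K := by
      have : (K + 1) ^ 2 = K ^ 2 + 2 * K + 1 := by ring
      omega
    simp only [Finset.card_range, nsmul_eq_mul, mul_one]
    exact_mod_cast this
  have hsplit : ∑ n ∈ Finset.range N, g n =
      ∑ n ∈ Finset.range (K ^ 2), g n + ∑ n ∈ Finset.range (N - K ^ 2), g (K ^ 2 + n) := by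
    rw [← Finset.sum_range_add, Nat.add_sub_cancel' hKN]
  rw [Real.norm_eq_abs, abs_div, Nat.abs_cast, hsplit]
  calc _ ≤ (|∑ n ∈ Finset.range (K ^ 2), g n| + 2 * K) / (K : ℝ) ^ 2 := by
        gcongr
        exact (abs_add_le _ _).trans (by gcongr)
    _ = _ := by
        simp only [Function.comp_apply, ← hK]
        rw [abs_div, abs_of_nonneg (sq_nonneg (K : ℝ))]
        field_simp

section Realization

variable {X : Type*} [MeasurableSpace X] {μ : Measure X} [IsProbabilityMeasure μ] {T : X → X}
  {A : Set X}

theorem abs_blockDiscrepancy_le (k r : ℕ) (x : X) :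
    |blockDiscrepancy μ T A k r x| ≤ 2 * k + 1 := by
  refine (Finset.abs_sum_le_sum_abs _ _).trans ?_
  refine (Finset.sum_le_card_nsmul _ _ 1 fun j _ =>
    abs_indicator_one_sub_le _ _ ⟨measureReal_nonneg, measureReal_le_one⟩).trans ?_
  simp

theorem integrable_indicator_iterate (hT : MeasurePreserving T μ μ) (hA : MeasurableSet A)
    (r j : ℕ) :
    Integrable (fun x => (A ∩ T^[r] ⁻¹' A).indicator (1 : X → ℝ) (T^[j] x)) μ := by
  have hm : MeasurableSet (A ∩ T^[r] ⁻¹' A) := hA.inter ((hT.iterate r).measurable hA)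
  exact (hT.iterate j).integrable_comp_of_integrable ((integrable_const (1 : ℝ)).indicator hm)

theorem integrable_blockDiscrepancy (hT : MeasurePreserving T μ μ) (hA : MeasurableSet A)
    (k r : ℕ) : Integrable (blockDiscrepancy μ T A k r) μ :=
  integrable_finsetSum _ fun j _ =>
    (integrable_indicator_iterate hT hA r j).sub (integrable_const _)

theorem integral_blockDiscrepancy (hT : MeasurePreserving T μ μ) (hA : MeasurableSet A)
    (k r : ℕ) : ∫ x, blockDiscrepancy μ T A k r x ∂μ = 0 := by
  have hm : MeasurableSet (A ∩ T^[r] ⁻¹' A) := hA.inter ((hT.iterate r).measurable hA)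
  unfold blockDiscrepancy
  rw [integral_finsetSum]
  swap
  · exact fun j _ => (integrable_indicator_iterate hT hA r j).sub (integrable_const _)
  refine Finset.sum_eq_zero fun j _ => ?_
  rw [integral_sub (integrable_indicator_iterate hT hA r j) (integrable_const _)]
  have : ∫ x, (A ∩ T^[r] ⁻¹' A).indicator (1 : X → ℝ) (T^[j] x) ∂μ =
      μ.real (A ∩ T^[r] ⁻¹' A) := by
    rw [← integral_indicator_one hm]
    conv_rhs => rw [← (hT.iterate j).map_eq]
    rw [integral_map (hT.iterate j).measurable.aemeasurable]
    exact (measurable_one.indicator hm).aestronglyMeasurable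
  rw [this]
  simp

theorem exists_sum_mul_blockDiscrepancy_nonpos (hT : MeasurePreserving T μ μ)
    (hA : MeasurableSet A) (k : ℕ) (s : ℕ → ℝ) :
    ∃ x, ∑ r ∈ Finset.range (k + 1), s r * blockDiscrepancy μ T A k r x ≤ 0 := by
  have hint : ∀ r ∈ Finset.range (k + 1),
      Integrable (fun x => s r * blockDiscrepancy μ T A k r x) μ := fun r _ =>
    (integrable_blockDiscrepancy hT hA k r).const_mul _
  obtain ⟨x, hx⟩ := exists_le_integral (integrable_finsetSum _ hint)
  refine ⟨x, hx.trans_eq ?_⟩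
  rw [integral_finsetSum _ hint]
  refine Finset.sum_eq_zero fun r _ => ?_
  rw [integral_const_mul, integral_blockDiscrepancy hT hA, mul_zero]

/-- Greedy derandomization: points can be chosen one after the other so that the accumulated
discrepancy of every correlation is small compared with the accumulated length. -/
theorem exists_seq_sum_blockDiscrepancy_sq_le (hT : MeasurePreserving T μ μ)
    (hA : MeasurableSet A) :
    ∃ x : ℕ → X, ∀ K r : ℕ,
      (∑ k ∈ Finset.range K, if r ≤ k then blockDiscrepancy μ T A k r (x k) else 0) ^ 2 ≤
        2 ^ r * (8 * (K : ℝ) ^ 3) := by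
  choose f hf using exists_sum_mul_blockDiscrepancy_nonpos (μ := μ) (T := T) (A := A) hT hA
  let w : ℕ → ℝ := fun r => (1 / 2) ^ r
  have hw : ∀ r, 0 < w r := fun r => by positivity
  let next : ℕ → (ℕ → ℝ) → X := fun k s => f k fun r => w r * s r
  let S : ℕ → ℕ → ℝ := fun K => Nat.rec (fun _ => 0)
    (fun k s r => s r + if r ≤ k then blockDiscrepancy μ T A k r (next k s) else 0) K
  let x : ℕ → X := fun k => next k (S k)
  have hS_succ (k r : ℕ) :
      S (k + 1) r = S k r + if r ≤ k then blockDiscrepancy μ T A k r (x k) else 0 := rfl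
  have hS (K r : ℕ) :
      S K r = ∑ k ∈ Finset.range K,
        if r ≤ k then blockDiscrepancy μ T A k r (x k) else 0 := by
    induction K with
    | zero => rfl
    | succ K ih => rw [Finset.sum_range_succ, hS_succ, ih]
  have key (M K : ℕ) (hK : K ≤ M) :
      ∑ r ∈ Finset.range M, w r * S K r ^ 2 ≤ 8 * (K : ℝ) ^ 3 := by
    induction K with
    | zero => simp [S]
    | succ K ih =>
      have hcross : ∑ r ∈ Finset.range M, w r * S K r *
          (if r ≤ K then blockDiscrepancy μ T A K r (x K) else 0) ≤ 0 := by
        have hsub : Finset.range (K + 1) ⊆ Finset.range M := by simpa using hK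
        rw [← Finset.sum_subset hsub]
        · refine le_trans (le_of_eq ?_) (hf K fun r => w r * S K r)
          refine Finset.sum_congr rfl fun r hr => ?_
          rw [if_pos (by simpa [Nat.lt_succ_iff] using hr)]
        · intro r _ hr
          rw [if_neg (by simpa [Nat.lt_succ_iff] using hr), mul_zero]
      have hsq : ∑ r ∈ Finset.range M, w r *
          (if r ≤ K then blockDiscrepancy μ T A K r (x K) else 0) ^ 2 ≤
            2 * (2 * (K : ℝ) + 1) ^ 2 := by
        calc _ ≤ ∑ r ∈ Finset.range M, w r * (2 * (K : ℝ) + 1) ^ 2 := by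
              refine Finset.sum_le_sum fun r _ => ?_
              refine mul_le_mul_of_nonneg_left ?_ (hw r).le
              split_ifs
              · exact sq_le_sq' (abs_le.1 (abs_blockDiscrepancy_le K r _)).1
                  (abs_le.1 (abs_blockDiscrepancy_le K r _)).2
              · rw [zero_pow two_ne_zero]
                positivity
          _ ≤ _ := by
              rw [← Finset.sum_mul]
              exact mul_le_mul_of_nonneg_right (sum_geometric_two_le M) (by positivity)
      have hexp : ∑ r ∈ Finset.range M, w r * S (K + 1) r ^ 2 =
          ∑ r ∈ Finset.range M, w r * S K r ^ 2 +
          2 * ∑ r ∈ Finset.range M, w r * S K r *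
            (if r ≤ K then blockDiscrepancy μ T A K r (x K) else 0) +
          ∑ r ∈ Finset.range M, w r *
            (if r ≤ K then blockDiscrepancy μ T A K r (x K) else 0) ^ 2 := by
        rw [Finset.mul_sum, ← Finset.sum_add_distrib, ← Finset.sum_add_distrib]
        refine Finset.sum_congr rfl fun r _ => ?_
        rw [hS_succ]
        ring
      have := ih (by omega)
      have hK0 : (0 : ℝ) ≤ K := Nat.cast_nonneg K
      push_cast
      rw [hexp]
      nlinarith [sq_nonneg (K : ℝ)]
  refine ⟨x, fun K r => ?_⟩
  rw [← hS]
  have h1 := key (max K (r + 1)) K (le_max_left _ _)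
  have h2 : w r * S K r ^ 2 ≤ 8 * (K : ℝ) ^ 3 := by
    refine le_trans ?_ h1
    exact Finset.single_le_sum (f := fun r => w r * S K r ^ 2)
      (fun i _ => mul_nonneg (hw i).le (sq_nonneg _)) (by simp)
  have h3 : (2 : ℝ) ^ r * w r = 1 := by
    simp only [w]
    rw [← mul_pow]
    norm_num
  calc S K r ^ 2 = 2 ^ r * (w r * S K r ^ 2) := by rw [← mul_assoc, h3, one_mul]
    _ ≤ _ := by gcongr

theorem abs_sum_block_sub_le (x : ℕ → X) (k r : ℕ) :
    |∑ j ∈ Finset.range (2 * k + 1),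
        ((blockItinerary T A x ∩ {m | m + r ∈ blockItinerary T A x}).indicator
          (1 : ℕ → ℝ) (k ^ 2 + j) - μ.real (A ∩ T^[r] ⁻¹' A)) -
      (if r ≤ k then blockDiscrepancy μ T A k r (x k) else 0)| ≤ 4 * r + 1 := by
  set D := blockItinerary T A x ∩ {m | m + r ∈ blockItinerary T A x} with hD
  split_ifs with hr
  · rw [blockDiscrepancy, ← Finset.sum_sub_distrib]
    refine (Finset.abs_sum_le_sum_abs _ _).trans ?_
    have hle : ∀ j ∈ Finset.range (2 * k + 1),
        |D.indicator (1 : ℕ → ℝ) (k ^ 2 + j) - μ.real (A ∩ T^[r] ⁻¹' A) -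
          ((A ∩ T^[r] ⁻¹' A).indicator (1 : X → ℝ) (T^[j] (x k)) -
            μ.real (A ∩ T^[r] ⁻¹' A))| ≤ if 2 * k + 1 ≤ j + r then 1 else 0 := by
      intro j hj
      rw [sub_sub_sub_cancel_right]
      split_ifs with hjr
      · exact abs_indicator_one_sub_le _ _ (indicator_one_mem_Icc _ _)
      · have hiff : k ^ 2 + j ∈ D ↔ T^[j] (x k) ∈ A ∩ T^[r] ⁻¹' A := by
          rw [hD, Set.mem_inter_iff, Set.mem_inter_iff, Set.mem_preimage,
            mem_blockItinerary_iff x (by simpa using hj), ← Function.iterate_add_apply,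
            Nat.add_comm r j, ← mem_blockItinerary_iff x (by omega : j + r < 2 * k + 1)]
          simp [Nat.add_assoc]
        simp [Set.indicator_apply, hiff]
    refine (Finset.sum_le_sum hle).trans ?_
    rw [Finset.sum_boole]
    have hcard : ((Finset.range (2 * k + 1)).filter fun j => 2 * k + 1 ≤ j + r).card ≤ r := by
      have : (Finset.range (2 * k + 1)).filter (fun j => 2 * k + 1 ≤ j + r) ⊆
          Finset.Ico (2 * k + 1 - r) (2 * k + 1) := by
        intro j hj
        simp only [Finset.mem_filter, Finset.mem_range, Finset.mem_Ico] at hj ⊢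
        omega
      refine (Finset.card_le_card this).trans ?_
      rw [Nat.card_Ico]
      omega
    have : ((((Finset.range (2 * k + 1)).filter fun j => 2 * k + 1 ≤ j + r).card : ℕ) : ℝ) ≤ r := by
      exact_mod_cast hcard
    have : (0 : ℝ) ≤ r := Nat.cast_nonneg r
    linarith
  · rw [sub_zero]
    refine (Finset.abs_sum_le_sum_abs _ _).trans
      ((Finset.sum_le_card_nsmul _ _ 1 fun j _ =>
        abs_indicator_one_sub_le _ _ ⟨measureReal_nonneg, measureReal_le_one⟩).trans ?_)
    have : (k : ℝ) ≤ r := by exact_mod_cast (not_le.1 hr).le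
    simp only [Finset.card_range, nsmul_eq_mul, mul_one]
    push_cast
    linarith

/-- Every correlation function `r ↦ μ (A ∩ T^{-r} A)` of a measure preserving system is realized
by the densities of the sets `E ∩ (E - r)` for some `E ⊆ ℕ`. -/
theorem exists_upperDensity_eq_measureReal (hT : MeasurePreserving T μ μ)
    (hA : MeasurableSet A) :
    ∃ E : Set ℕ, ∀ r, upperDensity (fun N => Finset.range N) (E ∩ {m | m + r ∈ E}) =
      μ.real (A ∩ T^[r] ⁻¹' A) := by
  obtain ⟨x, hx⟩ := exists_seq_sum_blockDiscrepancy_sq_le (μ := μ) hT hA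
  refine ⟨blockItinerary T A x, fun r => ?_⟩
  rw [upperDensity_range_eq]
  refine Tendsto.limsup_eq ?_
  set D := blockItinerary T A x ∩ {m | m + r ∈ blockItinerary T A x} with hD
  set c := μ.real (A ∩ T^[r] ⁻¹' A) with hc
  have hbound (K : ℕ) : |∑ n ∈ Finset.range (K ^ 2), (D.indicator (1 : ℕ → ℝ) n - c)| ≤
      √(2 ^ r * (8 * (K : ℝ) ^ 3)) + (4 * r + 1) * K := by
    have h1 := Real.abs_le_sqrt (hx K r)
    have h2 : |∑ k ∈ Finset.range K, (∑ j ∈ Finset.range (2 * k + 1),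
        (D.indicator (1 : ℕ → ℝ) (k ^ 2 + j) - c) -
          (if r ≤ k then blockDiscrepancy μ T A k r (x k) else 0))| ≤ (4 * r + 1) * K := by
      refine (Finset.abs_sum_le_sum_abs _ _).trans
        ((Finset.sum_le_card_nsmul _ _ _ fun k _ => abs_sum_block_sub_le x k r).trans ?_)
      rw [Finset.card_range, nsmul_eq_mul, mul_comm]
    rw [Finset.sum_sub_distrib] at h2
    rw [sum_range_sq_eq_sum_blocks]
    have h3 := abs_add_le (∑ k ∈ Finset.range K,
      if r ≤ k then blockDiscrepancy μ T A k r (x k) else 0) (∑ k ∈ Finset.range K,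
        ∑ j ∈ Finset.range (2 * k + 1), (D.indicator (1 : ℕ → ℝ) (k ^ 2 + j) - c) -
      ∑ k ∈ Finset.range K, if r ≤ k then blockDiscrepancy μ T A k r (x k) else 0)
    rw [add_sub_cancel] at h3
    linarith
  have hlim : Tendsto (fun K : ℕ => √(2 ^ r * 8) / √(K : ℝ) + (4 * r + 1) / (K : ℝ)) atTop
      (nhds 0) := by
    have h1 : Tendsto (fun K : ℕ => √(2 ^ r * 8) / √(K : ℝ)) atTop (nhds 0) :=
      tendsto_const_nhds.div_atTop (Real.tendsto_sqrt_atTop.comp tendsto_natCast_atTop_atTop)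
    have h2 : Tendsto (fun K : ℕ => (4 * r + 1) / (K : ℝ)) atTop (nhds 0) :=
      tendsto_const_nhds.div_atTop tendsto_natCast_atTop_atTop
    simpa using h1.add h2
  have hsq : Tendsto (fun K : ℕ =>
      (∑ n ∈ Finset.range (K ^ 2), (D.indicator (1 : ℕ → ℝ) n - c)) / (K : ℝ) ^ 2) atTop
      (nhds 0) := by
    refine squeeze_zero_norm' ?_ hlim
    filter_upwards [eventually_ge_atTop 1] with K hK
    have hKpos : (0 : ℝ) < K := by exact_mod_cast hK
    rw [Real.norm_eq_abs, abs_div, abs_of_nonneg (sq_nonneg (K : ℝ)),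
      div_le_iff₀ (by positivity)]
    refine (hbound K).trans (le_of_eq ?_)
    have hs : √(2 ^ r * (8 * (K : ℝ) ^ 3)) = √(2 ^ r * 8) * (√(K : ℝ) * K) := by
      rw [show (2 : ℝ) ^ r * (8 * (K : ℝ) ^ 3) = (2 ^ r * 8) * (K * K ^ 2) by ring,
        Real.sqrt_mul (by positivity), Real.sqrt_mul hKpos.le, Real.sqrt_sq hKpos.le]
    rw [hs]
    have hss : √(K : ℝ) ^ 2 = K := Real.sq_sqrt hKpos.le
    have hspos : 0 < √(K : ℝ) := Real.sqrt_pos.2 hKpos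
    field_simp
    rw [mul_add, mul_left_comm, ← pow_two, hss]
  have hg : ∀ n, |D.indicator (1 : ℕ → ℝ) n - c| ≤ 1 := fun n =>
    abs_indicator_one_sub_le _ _ ⟨measureReal_nonneg, measureReal_le_one⟩
  have h := (tendsto_average_of_tendsto_average_sq hg hsq).add_const c
  rw [zero_add] at h
  refine h.congr' ?_
  filter_upwards [eventually_ge_atTop 1] with N hN
  have hNpos : (0 : ℝ) < N := by exact_mod_cast hN
  rw [Finset.sum_sub_distrib, Finset.sum_const, Finset.card_range, nsmul_eq_mul]
  field_simp
  ring

end Realization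

/-- A set `R ⊆ ℕ` is a set of nice recurrence iff it is `({0, …, N-1})`-nicely
intersective. -/
theorem niceRecurrence_iff_nicelyIntersective_range (R : Set ℕ) :
    IsNiceRecurrenceSet R ↔ NicelyIntersective (fun N => Finset.range N) R := by
  constructor
  · intro h E ε hε
    obtain ⟨ν, hν, A, hT, hA, hAE, hle⟩ := exists_measurePreserving_le_upperDensity E
    obtain ⟨r, hr, hr0, hlt⟩ := h _ _ ν leftShift hν hT.measurable hT A hA ε hε
    refine ⟨r, hr, hr0, ?_⟩
    rw [← hAE]
    exact lt_of_lt_of_le hlt (hle r)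
  · intro h X _ μ T hμ _ hT A hA ε hε
    obtain ⟨E, hE⟩ := exists_upperDensity_eq_measureReal hT hA
    obtain ⟨r, hr, hr0, hlt⟩ := h E ε hε
    refine ⟨r, hr, hr0, ?_⟩
    have h0 := hE 0
    simp only [Function.iterate_zero, Set.preimage_id, Set.inter_self, add_zero,
      Set.ofPred_mem_eq] at h0
    rw [hE r, h0] at hlt
    exact hlt
end

section
/- If R ⊆ ℕ is a set of nice recurrence, then for every Følner sequence (F_N) in ℕ the set R is (F_N)-nicely intersective: for every E ⊆ ℕ and every ε > 0 there exists a nonzero r ∈ R with d̄_{(F_N)}(E ∩ (E − r)) > d̄_{(F_N)}(E)² − ε. -/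
open MeasureTheory Filter
open scoped Classical symmDiff

/-- The proportion of elements of the finite set `S` that lie in `E`. -/
noncomputable def relDensity (S : Finset ℕ) (E : Set ℕ) : ℝ :=
  ((S.filter (· ∈ E)).card : ℝ) / S.card

lemma relDensity_nonneg (S : Finset ℕ) (E : Set ℕ) : 0 ≤ relDensity S E := by
  unfold relDensity; positivity

lemma relDensity_le_one (S : Finset ℕ) (E : Set ℕ) : relDensity S E ≤ 1 :=
  div_le_one_of_le₀ (by exact_mod_cast Finset.card_filter_le _ _) (by positivity)

lemma isBoundedUnder_le_relDensity (F : ℕ → Finset ℕ) (E : Set ℕ) (l : Filter ℕ) :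
    l.IsBoundedUnder (· ≤ ·) (fun N => relDensity (F N) E) :=
  isBoundedUnder_of ⟨1, fun _ => relDensity_le_one _ _⟩

lemma isBoundedUnder_ge_relDensity (F : ℕ → Finset ℕ) (E : Set ℕ) (l : Filter ℕ) :
    l.IsBoundedUnder (· ≥ ·) (fun N => relDensity (F N) E) :=
  isBoundedUnder_of ⟨0, fun _ => relDensity_nonneg _ _⟩

lemma upperDensity_nonneg (F : ℕ → Finset ℕ) (E : Set ℕ) : 0 ≤ upperDensity F E :=
  le_limsup_of_frequently_le (Frequently.of_forall fun N => relDensity_nonneg (F N) E)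
    (isBoundedUnder_le_relDensity F E atTop)

/-- A limit of relative densities along an ultrafilter is at most the upper density. -/
lemma le_upperDensity_of_tendsto {F : ℕ → Finset ℕ} {E : Set ℕ} {U : Ultrafilter ℕ}
    (hU : (U : Filter ℕ) ≤ atTop) {c : ℝ}
    (h : Tendsto (fun N => relDensity (F N) E) U (nhds c)) : c ≤ upperDensity F E :=
  (mapClusterPt_iff_ultrafilter.2 ⟨U, hU, h⟩).le_limsup (isBoundedUnder_le_relDensity F E atTop)

/-- The upper density is attained as a limit of relative densities along an ultrafilter. -/
lemma exists_ultrafilter_tendsto_upperDensity (F : ℕ → Finset ℕ) (E : Set ℕ) :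
    ∃ U : Ultrafilter ℕ, (U : Filter ℕ) ≤ atTop ∧
      Tendsto (fun N => relDensity (F N) E) U (nhds (upperDensity F E)) :=
  mapClusterPt_iff_ultrafilter.1 <| MapClusterPt.limsup
    (isBoundedUnder_ge_relDensity F E atTop).isCoboundedUnder_le
    (isBoundedUnder_le_relDensity F E atTop)

lemma abs_relDensity_preimage_succ_sub_le (S : Finset ℕ) (B : Set ℕ) :
    |relDensity S {m | m + 1 ∈ B} - relDensity S B| ≤
      ((S ∆ (S.image (· + 1))).card : ℝ) / S.card := by
  have hcard : (S.filter (· ∈ {m | m + 1 ∈ B})).card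
      = ((S.image (· + 1)).filter (· ∈ B)).card := by
    rw [Finset.filter_image, Finset.card_image_of_injective _ (add_left_injective 1)]
    rfl
  have aux : ∀ P Q : Finset ℕ,
      (P.filter (· ∈ B)).card ≤ (Q.filter (· ∈ B)).card + (P ∆ Q).card := by
    intro P Q
    refine (Finset.card_le_card ?_).trans (Finset.card_union_le _ _)
    intro x hx
    simp only [Finset.mem_filter, Finset.mem_union, Finset.mem_symmDiff] at hx ⊢
    tauto
  have h1 := aux S (S.image (· + 1))
  have h2 := aux (S.image (· + 1)) S
  rw [symmDiff_comm] at h2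
  rw [relDensity, relDensity, hcard, ← sub_div, abs_div, Nat.abs_cast]
  gcongr
  rw [abs_le]
  constructor
  · have : ((S.filter (· ∈ B)).card : ℝ) ≤
      ((S.image (· + 1)).filter (· ∈ B)).card + (S ∆ (S.image (· + 1))).card := by
      exact_mod_cast h1
    linarith
  · have : (((S.image (· + 1)).filter (· ∈ B)).card : ℝ) ≤
      (S.filter (· ∈ B)).card + (S ∆ (S.image (· + 1))).card := by
      exact_mod_cast h2
    linarith

lemma IsFolner.tendsto_relDensity_preimage_succ_sub {F : ℕ → Finset ℕ} (hF : IsFolner F)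
    (B : Set ℕ) :
    Tendsto (fun N => relDensity (F N) {m | m + 1 ∈ B} - relDensity (F N) B) atTop (nhds 0) :=
  squeeze_zero_norm (fun N => abs_relDensity_preimage_succ_sub_le (F N) B) (hF 1)

/-- Relative densities in a nonempty finite set `S` are computed by a probability measure on `ℕ`. -/
lemma exists_probabilityMeasure_eq_relDensity (S : Finset ℕ) :
    ∃ ν : ProbabilityMeasure ℕ, S.Nonempty → ∀ B : Set ℕ, (ν B : ℝ) = relDensity S B := by
  by_cases hS : S.Nonempty
  · refine ⟨⟨ProbabilityTheory.uniformOn (S : Set ℕ),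
      ProbabilityTheory.isProbabilityMeasure_uniformOn S.finite_toSet hS⟩, fun _ B => ?_⟩
    change (ProbabilityTheory.uniformOn (S : Set ℕ) B).toReal = _
    have hinter : (S : Set ℕ) ∩ B = ((S.filter (· ∈ B) : Finset ℕ) : Set ℕ) := by
      ext; simp
    rw [← ProbabilityTheory.uniformOn_inter_self S.finite_toSet, hinter,
      ProbabilityTheory.uniformOn_apply_finset,
      Finset.inter_eq_right.2 (Finset.filter_subset _ _), relDensity]
    simp
  · exact ⟨⟨Measure.dirac 0, inferInstance⟩, fun h => absurd h hS⟩

/-- A finite measure on a compact totally disconnected second countable space is preserved by a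
continuous map as soon as the measures of clopen sets are. -/
lemma measurePreserving_of_forall_isClopen {X : Type*} [TopologicalSpace X] [T2Space X]
    [CompactSpace X] [TotallyDisconnectedSpace X] [SecondCountableTopology X]
    [MeasurableSpace X] [BorelSpace X] {μ : Measure X} [IsFiniteMeasure μ] {T : X → X}
    (hT : Continuous T) (h : ∀ C : Set X, IsClopen C → μ (T ⁻¹' C) = μ C) :
    MeasurePreserving T μ μ := by
  refine ⟨hT.measurable, ?_⟩
  refine ext_of_generate_finite {s : Set X | IsClopen s} ?_ ?_ ?_ ?_
  · rw [BorelSpace.measurable_eq (α := X)]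
    exact isTopologicalBasis_isClopen.borel_eq_generateFrom
  · exact fun s hs t ht _ => hs.inter ht
  · intro C (hC : IsClopen C)
    rw [Measure.map_apply hT.measurable hC.isOpen.measurableSet, h C hC]
  · rw [Measure.map_apply hT.measurable MeasurableSet.univ, Set.preimage_univ]

/-- The shift on binary sequences. -/
def binaryShift (x : ℕ → Bool) : ℕ → Bool := fun k => x (k + 1)

lemma continuous_binaryShift : Continuous binaryShift :=
  continuous_pi fun k => continuous_apply (k + 1)

lemma iterate_binaryShift_apply (r : ℕ) (x : ℕ → Bool) (k : ℕ) :
    (binaryShift^[r] x) k = x (k + r) := by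
  induction r generalizing x with
  | zero => rfl
  | succ r ih => rw [Function.iterate_succ_apply, ih, binaryShift, add_assoc]

/-- The **Furstenberg correspondence principle** for upper densities along a Følner sequence. -/
lemma exists_measurePreserving_binaryShift {F : ℕ → Finset ℕ} (hF : IsFolner F) {E : Set ℕ}
    (hE : 0 < upperDensity F E) :
    ∃ μ : ProbabilityMeasure (ℕ → Bool),
      MeasurePreserving binaryShift (μ : Measure (ℕ → Bool)) μ ∧
      (μ {x | x 0 = true} : ℝ) = upperDensity F E ∧
      ∀ r, (μ ({x | x 0 = true} ∩ binaryShift^[r] ⁻¹' {x | x 0 = true}) : ℝ) ≤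
        upperDensity F (E ∩ {m | m + r ∈ E}) := by
  obtain ⟨U, hU, hlim⟩ := exists_ultrafilter_tendsto_upperDensity F E
  choose ν hν using fun N => exists_probabilityMeasure_eq_relDensity (F N)
  have hne : ∀ᶠ N in (U : Filter ℕ), (F N).Nonempty := by
    filter_upwards [hlim.eventually (lt_mem_nhds hE)] with N hN
    by_contra h
    simp [relDensity, Finset.not_nonempty_iff_eq_empty.1 h] at hN
  let orbit : ℕ → ℕ → Bool := fun n k => decide (n + k ∈ E)
  have horbit : Measurable orbit := measurable_from_top
  let μs : ℕ → ProbabilityMeasure (ℕ → Bool) := fun N => (ν N).map horbit.aemeasurable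
  obtain ⟨μ, -, hμ⟩ := isCompact_univ.ultrafilter_le_nhds (U.map μs) (by simp)
  have hμ' : Tendsto μs U (nhds μ) := hμ
  have hclopen : ∀ C : Set (ℕ → Bool), IsClopen C →
      Tendsto (fun N => relDensity (F N) (orbit ⁻¹' C)) U (nhds (μ C : ℝ)) := by
    intro C hC
    have h := (NNReal.continuous_coe.tendsto _).comp
      (ProbabilityMeasure.tendsto_measure_of_isClopen_of_tendsto hμ' hC)
    refine h.congr' ?_
    filter_upwards [hne] with N hN
    rw [← hν N hN]
    simp only [Function.comp_apply, μs]
    rw [ProbabilityMeasure.map_apply _ _ hC.isOpen.measurableSet]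
  have hzero : IsClopen {x : ℕ → Bool | x 0 = true} :=
    (isClopen_discrete {true}).preimage (continuous_apply 0)
  have hshift : ∀ n, binaryShift (orbit n) = orbit (n + 1) := by
    intro n
    funext k
    simp only [binaryShift, orbit, add_assoc, add_comm 1 k]
  refine ⟨μ, measurePreserving_of_forall_isClopen continuous_binaryShift ?_, ?_, ?_⟩
  · intro C hC
    have h1 := hclopen _ (hC.preimage continuous_binaryShift)
    have h2 := hclopen C hC
    have h3 := (hF.tendsto_relDensity_preimage_succ_sub (orbit ⁻¹' C)).mono_left hU
    have hpre : orbit ⁻¹' (binaryShift ⁻¹' C) = {m | m + 1 ∈ orbit ⁻¹' C} := by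
      ext n
      simp [hshift]
    rw [hpre] at h1
    have h4 := sub_eq_zero.1 (tendsto_nhds_unique (h1.sub h2) h3)
    rw [← ProbabilityMeasure.ennreal_coeFn_eq_coeFn_toMeasure,
      ← ProbabilityMeasure.ennreal_coeFn_eq_coeFn_toMeasure, NNReal.coe_injective h4]
  · refine tendsto_nhds_unique (hclopen _ hzero) ?_
    convert hlim using 3
    ext n
    simp [orbit]
  · intro r
    refine le_upperDensity_of_tendsto hU ?_
    convert hclopen _ (hzero.inter (hzero.preimage (continuous_binaryShift.iterate r))) using 3
    ext n
    simp [orbit, iterate_binaryShift_apply]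

/-- A set of nice recurrence is `(F_N)`-nicely intersective for every Følner sequence. -/
theorem niceRecurrence_nicelyIntersective (R : Set ℕ) (hR : IsNiceRecurrenceSet R)
    (F : ℕ → Finset ℕ) (hF : IsFolner F) : NicelyIntersective F R := by
  intro E ε hε
  rcases (upperDensity_nonneg F E).eq_or_lt with hE | hE
  · obtain ⟨r, hr, hr0, -⟩ := hR Unit inferInstance (Measure.dirac ()) id inferInstance
      measurable_id (MeasurePreserving.id _) Set.univ MeasurableSet.univ ε hε
    refine ⟨r, hr, hr0, ?_⟩
    have := upperDensity_nonneg F (E ∩ {m : ℕ | m + r ∈ E})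
    rw [← hE]
    linarith
  · obtain ⟨μ, hμ, hμE, hμr⟩ := exists_measurePreserving_binaryShift hF hE
    obtain ⟨r, hr, hr0, h⟩ := hR (ℕ → Bool) inferInstance μ binaryShift inferInstance
      hμ.measurable hμ {x | x 0 = true}
      (measurableSet_eq_fun (measurable_pi_apply 0) measurable_const) ε hε
    refine ⟨r, hr, hr0, lt_of_lt_of_le ?_ (hμr r)⟩
    rw [← hμE]
    exact h
end

section
/- Uniformity of recurrence: let R ⊆ ℕ be a set of recurrence. Then for every δ > 0 there exist a positive integer N₀ and a real ε > 0 such that for every measure preserving system (X, μ, T) and every measurable set A ⊆ X with μ(A) ≥ δ, there exists r ∈ R with 1 ≤ r ≤ N₀ and μ(A ∩ T^{−r}A) ≥ ε. -/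
open MeasureTheory Filter
open scoped Classical symmDiff

/-- The left shift on binary sequences. -/
def boolShift (y : ℕ → Bool) : ℕ → Bool := fun i => y (i + 1)

/-- The cylinder of binary sequences whose initial term is `true`. -/
def trueCylinder : Set (ℕ → Bool) := {y | y 0 = true}

/-- The sequence recording at which times the orbit of `x` under `T` visits `A`. -/
noncomputable def itinerary {X : Type*} (T : X → X) (A : Set X) (x : X) : ℕ → Bool :=
  fun i => decide (T^[i] x ∈ A)

lemma itinerary_eq_true_iff {X : Type*} (T : X → X) (A : Set X) (x : X) (i : ℕ) :
    itinerary T A x i = true ↔ T^[i] x ∈ A :=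
  decide_eq_true_iff

lemma continuous_boolShift : Continuous boolShift :=
  continuous_pi fun i => continuous_apply (i + 1)

lemma isClopen_trueCylinder : IsClopen trueCylinder :=
  (isClopen_discrete {true}).preimage (continuous_apply 0)

lemma isClopen_trueCylinder_inter (r : ℕ) :
    IsClopen (trueCylinder ∩ boolShift^[r] ⁻¹' trueCylinder) :=
  isClopen_trueCylinder.inter (isClopen_trueCylinder.preimage (continuous_boolShift.iterate r))

lemma measurable_itinerary {X : Type*} [MeasurableSpace X] {T : X → X} (hT : Measurable T)
    {A : Set X} (hA : MeasurableSet A) : Measurable (itinerary T A) := by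
  refine measurable_pi_lambda _ fun i => measurable_to_bool ?_
  have : (fun x => itinerary T A x i) ⁻¹' {true} = T^[i] ⁻¹' A := by
    ext x; exact itinerary_eq_true_iff T A x i
  rw [this]
  exact hT.iterate i hA

lemma itinerary_semiconj {X : Type*} (T : X → X) (A : Set X) :
    Function.Semiconj (itinerary T A) T boolShift := by
  intro x
  ext i
  rfl

lemma itinerary_preimage_trueCylinder {X : Type*} (T : X → X) (A : Set X) :
    itinerary T A ⁻¹' trueCylinder = A := by
  ext x; exact itinerary_eq_true_iff T A x 0

lemma itinerary_preimage_inter {X : Type*} (T : X → X) (A : Set X) (r : ℕ) :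
    itinerary T A ⁻¹' (trueCylinder ∩ boolShift^[r] ⁻¹' trueCylinder) = A ∩ T^[r] ⁻¹' A := by
  rw [Set.preimage_inter, ← Set.preimage_comp,
    ← ((itinerary_semiconj T A).iterate_right r).comp_eq, Set.preimage_comp, itinerary_preimage_trueCylinder]

/-- Evaluation of probability measures at a clopen set is continuous for weak convergence. -/
lemma continuous_probabilityMeasure_apply_of_isClopen {Y : Type*} [TopologicalSpace Y]
    [MeasurableSpace Y] [OpensMeasurableSpace Y] [HasOuterApproxClosed Y] {E : Set Y}
    (hE : IsClopen E) : Continuous fun ν : ProbabilityMeasure Y => ν E := by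
  refine continuous_iff_continuousAt.2 fun ν => ?_
  exact ProbabilityMeasure.tendsto_measure_of_null_frontier_of_tendsto tendsto_id
    (by simp [hE.frontier_eq])

/-- The shift-invariant measures giving mass at least `δ` to the cylinder form a compact set. -/
lemma isCompact_shiftInvariant (δ : ℝ) :
    IsCompact {ν : ProbabilityMeasure (ℕ → Bool) |
      ν.map continuous_boolShift.measurable.aemeasurable = ν ∧ δ ≤ ν trueCylinder} := by
  refine IsClosed.isCompact (IsClosed.inter ?_ ?_)
  · exact isClosed_eq (ProbabilityMeasure.continuous_map continuous_boolShift) continuous_id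
  · exact isClosed_le continuous_const (NNReal.continuous_coe.comp
      (continuous_probabilityMeasure_apply_of_isClopen isClopen_trueCylinder))

/-- Uniformity of recurrence: if `R` is a set of recurrence then for every `δ > 0` there
exist `N₀ ≥ 1` and `ε > 0` such that every measure preserving system `(X, μ, T)` and
measurable `A` with `μ(A) ≥ δ` satisfies `μ(A ∩ T^{-r}A) ≥ ε` for some `r ∈ R` with
`1 ≤ r ≤ N₀`. -/
theorem uniformity_of_recurrence (R : Set ℕ) (hR : IsRecurrenceSet R)
    (δ : ℝ) (hδ : 0 < δ) :
    ∃ (N₀ : ℕ) (ε : ℝ), 1 ≤ N₀ ∧ 0 < ε ∧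
      ∀ (X : Type) (_ : MeasurableSpace X) (μ : Measure X) (T : X → X),
        IsProbabilityMeasure μ → Measurable T → MeasurePreserving T μ μ →
        ∀ A : Set X, MeasurableSet A → δ ≤ (μ A).toReal →
          ∃ r ∈ R, 1 ≤ r ∧ r ≤ N₀ ∧ ε ≤ (μ (A ∩ T^[r] ⁻¹' A)).toReal := by
  have hcompact := isCompact_shiftInvariant δ
  let U : ℕ → Set (ProbabilityMeasure (ℕ → Bool)) := fun n =>
    ⋃ r ∈ {r | r ∈ R ∧ 1 ≤ r ∧ r ≤ n + 1},
      {ν | (1 : ℝ) / (n + 1) < ν (trueCylinder ∩ boolShift^[r] ⁻¹' trueCylinder)}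
  have hopen (n : ℕ) : IsOpen (U n) := isOpen_biUnion fun r _ =>
    isOpen_lt continuous_const (NNReal.continuous_coe.comp
      (continuous_probabilityMeasure_apply_of_isClopen (isClopen_trueCylinder_inter r)))
  have hmono : Monotone U := by
    intro m n hmn ν hν
    simp only [U, Set.mem_iUnion, Set.mem_ofPred_eq, exists_prop] at hν ⊢
    obtain ⟨r, ⟨hrR, hr1, hrm⟩, hr⟩ := hν
    exact ⟨r, ⟨hrR, hr1, by omega⟩, (Nat.one_div_le_one_div hmn).trans_lt hr⟩
  obtain ⟨n, hn⟩ := hcompact.elim_directed_cover U hopen (by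
    rintro ν ⟨hinv, hνδ⟩
    have hpres : MeasurePreserving boolShift (ν : Measure (ℕ → Bool)) ν :=
      ⟨continuous_boolShift.measurable, congrArg Subtype.val hinv⟩
    have hpos : 0 < (ν : Measure (ℕ → Bool)) trueCylinder := by
      rw [← ProbabilityMeasure.ennreal_coeFn_eq_coeFn_toMeasure]
      exact_mod_cast hδ.trans_le hνδ
    obtain ⟨r, hrR, hr0, hr⟩ := hR _ _ ν boolShift inferInstance hpres.measurable hpres
      trueCylinder isClopen_trueCylinder.isOpen.measurableSet hpos
    rw [← ProbabilityMeasure.ennreal_coeFn_eq_coeFn_toMeasure, ENNReal.coe_pos,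
      ← NNReal.coe_pos] at hr
    obtain ⟨k, hk⟩ := exists_nat_one_div_lt hr
    simp only [U, Set.mem_iUnion, Set.mem_ofPred_eq, exists_prop]
    exact ⟨max k r, r, ⟨hrR, by omega, by omega⟩,
      (Nat.one_div_le_one_div (le_max_left k r)).trans_lt hk⟩)
    hmono.directed_le
  refine ⟨n + 1, 1 / (n + 1), by omega, by positivity, ?_⟩
  intro X _ μ T hμ hT hpres A hA hδA
  have hφ := measurable_itinerary hT hA
  let ν : ProbabilityMeasure (ℕ → Bool) := ProbabilityMeasure.map ⟨μ, hμ⟩ hφ.aemeasurable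
  have hν {E : Set (ℕ → Bool)} (hE : MeasurableSet E) :
      (ν E : ℝ) = (μ (itinerary T A ⁻¹' E)).toReal := by
    exact congrArg ENNReal.toReal (Measure.map_apply hφ hE)
  have hmem := hn (show ν ∈ _ from ⟨by
    refine Subtype.ext ?_
    change (μ.map (itinerary T A)).map boolShift = μ.map (itinerary T A)
    rw [Measure.map_map continuous_boolShift.measurable hφ,
      ← (itinerary_semiconj T A).comp_eq, ← Measure.map_map hφ hT, hpres.map_eq], by
    rwa [hν isClopen_trueCylinder.isOpen.measurableSet, itinerary_preimage_trueCylinder]⟩)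
  simp only [U, Set.mem_iUnion, Set.mem_ofPred_eq, exists_prop] at hmem
  obtain ⟨r, ⟨hrR, hr1, hrn⟩, hr⟩ := hmem
  rw [hν (isClopen_trueCylinder_inter r).isOpen.measurableSet, itinerary_preimage_inter] at hr
  exact ⟨r, hrR, hr1, hrn, hr.le⟩
end

section
/- Sigmund's theorem for the full binary shift: every shift-invariant Borel probability measure ν on {0,1}^ℕ admits a ({0, …, N−1})-generic point, i.e. there exists x ∈ {0,1}^ℕ such that for every cylinder C ⊆ {0,1}^ℕ, (1/N) · #{ 0 ≤ i ≤ N−1 : σ^i(x) ∈ C } → ν(C) as N → ∞. -/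
open MeasureTheory Filter
open scoped Classical

/-- The left shift on `{0,1}^ℕ` (modelled as `ℕ → Bool`). -/
def binShift : (ℕ → Bool) → (ℕ → Bool) := fun ω n => ω (n + 1)

/-- `C` is a cylinder set in `{0,1}^ℕ`: it is cut out by finitely many coordinates. -/
def IsCylinder (C : Set (ℕ → Bool)) : Prop :=
  ∃ (r : ℕ) (n : Fin r → ℕ) (iv : Fin r → Bool),
    C = {ω : ℕ → Bool | ∀ j : Fin r, ω (n j) = iv j}

/-- A greedy selection: given countably many centered bounded observables at each time `n`, points
`y n` can be chosen one after the other so that the partial sums of every observable grow at most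
like the square root of the sum of the squared bounds. -/
theorem exists_seq_sum_sq_le_s10 {Ω : Type*} [MeasurableSpace Ω] (μ : Measure Ω)
    [IsProbabilityMeasure μ] (g : ℕ → ℕ → Ω → ℝ) (B : ℕ → ℝ)
    (hint : ∀ n j, Integrable (g n j) μ) (hmean : ∀ n j, ∫ y, g n j y ∂μ = 0)
    (hB : ∀ n j y, |g n j y| ≤ B n) :
    ∃ y : ℕ → Ω, ∀ j, ∃ c : ℝ, 0 < c ∧ ∀ n, j < n →
      c * (∑ i ∈ Finset.range n, g i j (y i)) ^ 2 ≤ 2 + 2 * ∑ i ∈ Finset.range n, B i ^ 2 := by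
  have hΩ : Nonempty Ω := nonempty_of_isProbabilityMeasure μ
  let A : ℕ → ℝ := fun j => ∑ i ∈ Finset.range (j + 1), B i
  let c : ℕ → ℝ := fun j => (1 / 2) ^ j / (1 + A j ^ 2)
  have hc : ∀ j, 0 < c j := fun j => by positivity
  have hstep : ∀ (n : ℕ) (S : ℕ → ℝ), ∃ y, ∑ j ∈ Finset.range n, c j * S j * g n j y ≤ 0 := by
    intro n S
    have hi : Integrable (fun y => ∑ j ∈ Finset.range n, c j * S j * g n j y) μ :=
      integrable_finsetSum _ fun j _ => (hint n j).const_mul _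
    obtain ⟨y, hy⟩ := exists_le_integral hi
    refine ⟨y, hy.trans_eq ?_⟩
    rw [integral_finsetSum _ fun j _ => (hint n j).const_mul _]
    simp [integral_const_mul, hmean]
  choose Y hY using hstep
  let S : ℕ → ℕ → ℝ := fun n => Nat.rec (fun _ => 0) (fun n s j => s j + g n j (Y n s)) n
  have hS : ∀ n j, S n j = ∑ i ∈ Finset.range n, g i j (Y i (S i)) := by
    intro n j
    induction n with
    | zero => rfl
    | succ n ih => rw [Finset.sum_range_succ, ← ih]
  have hgeom : ∀ n, ∑ j ∈ Finset.range n, (1 / 2 : ℝ) ^ j ≤ 2 := fun n =>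
    sum_geometric_two_le n
  have hQ : ∀ n, ∑ j ∈ Finset.range n, c j * S n j ^ 2 ≤
      ∑ j ∈ Finset.range n, (1 / 2 : ℝ) ^ j + 2 * ∑ i ∈ Finset.range n, B i ^ 2 := by
    intro n
    induction n with
    | zero => simp
    | succ n ih =>
      have hnew : c n * S (n + 1) n ^ 2 ≤ (1 / 2) ^ n := by
        have h1 : |S (n + 1) n| ≤ A n := by
          rw [hS (n + 1) n]
          exact (Finset.abs_sum_le_sum_abs _ _).trans (Finset.sum_le_sum fun i _ => hB _ _ _)
        have h2 : S (n + 1) n ^ 2 ≤ 1 + A n ^ 2 := by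
          have := sq_le_sq' (abs_le.1 h1).1 (abs_le.1 h1).2
          linarith
        calc c n * S (n + 1) n ^ 2 ≤ c n * (1 + A n ^ 2) := by gcongr
          _ = (1 / 2) ^ n := div_mul_cancel₀ _ (by positivity)
      have hsq : ∑ j ∈ Finset.range n, c j * g n j (Y n (S n)) ^ 2 ≤ 2 * B n ^ 2 := by
        calc ∑ j ∈ Finset.range n, c j * g n j (Y n (S n)) ^ 2
            ≤ ∑ j ∈ Finset.range n, (1 / 2 : ℝ) ^ j * B n ^ 2 := by
              refine Finset.sum_le_sum fun j _ => ?_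
              have h1 : c j ≤ (1 / 2) ^ j :=
                div_le_self (by positivity) (by nlinarith [sq_nonneg (A j)])
              have h2 := hB n j (Y n (S n))
              have h3 := sq_le_sq' (abs_le.1 h2).1 (abs_le.1 h2).2
              exact mul_le_mul h1 h3 (sq_nonneg _) (by positivity)
          _ ≤ 2 * B n ^ 2 := by
              rw [← Finset.sum_mul]
              gcongr
              exact hgeom n
      have hexp : ∑ j ∈ Finset.range n, c j * S (n + 1) j ^ 2 =
          ∑ j ∈ Finset.range n, c j * S n j ^ 2 +
            2 * ∑ j ∈ Finset.range n, c j * S n j * g n j (Y n (S n)) +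
            ∑ j ∈ Finset.range n, c j * g n j (Y n (S n)) ^ 2 := by
        rw [Finset.mul_sum, ← Finset.sum_add_distrib, ← Finset.sum_add_distrib]
        refine Finset.sum_congr rfl fun j _ => ?_
        have : S (n + 1) j = S n j + g n j (Y n (S n)) := rfl
        rw [this]
        ring
      rw [Finset.sum_range_succ, Finset.sum_range_succ, Finset.sum_range_succ, hexp]
      linarith [hY n (S n)]
  refine ⟨fun i => Y i (S i), fun j => ⟨c j, hc j, fun n hn => ?_⟩⟩
  rw [← hS]
  have h1 := Finset.single_le_sum (f := fun j => c j * S n j ^ 2)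
    (fun j _ => mul_nonneg (hc j).le (sq_nonneg _)) (Finset.mem_range.2 hn)
  linarith [hQ n, hgeom n]

theorem binShift_iterate_apply (i : ℕ) (ω : ℕ → Bool) (m : ℕ) :
    binShift^[i] ω m = ω (i + m) := by
  induction i generalizing ω with
  | zero => simp
  | succ i ih =>
    rw [Function.iterate_succ_apply, ih, binShift]
    congr 1
    omega

theorem countable_isCylinder : {C | IsCylinder C}.Countable := by
  refine (Set.countable_range fun p : Σ r : ℕ, (Fin r → ℕ) × (Fin r → Bool) =>
    {ω : ℕ → Bool | ∀ j, ω (p.2.1 j) = p.2.2 j}).mono ?_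
  rintro C ⟨r, n, iv, rfl⟩
  exact ⟨⟨r, n, iv⟩, rfl⟩

theorem IsCylinder.measurableSet {C : Set (ℕ → Bool)} (hC : IsCylinder C) : MeasurableSet C := by
  obtain ⟨r, n, iv, rfl⟩ := hC
  rw [Set.ofPred_forall]
  exact MeasurableSet.iInter fun j => measurableSet_eq_fun (measurable_pi_apply (n j)) measurable_const

theorem IsCylinder.exists_mem_iff {C : Set (ℕ → Bool)} (hC : IsCylinder C) :
    ∃ k : ℕ, ∀ ω ω' : ℕ → Bool, (∀ m < k, ω m = ω' m) → (ω ∈ C ↔ ω' ∈ C) := by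
  obtain ⟨r, n, iv, rfl⟩ := hC
  refine ⟨Finset.univ.sup n + 1, fun ω ω' h => forall_congr' fun j => ?_⟩
  rw [h _ (Nat.lt_succ_of_le (Finset.le_sup (Finset.mem_univ j)))]

/-- The concatenation of the initial words of length `2 * i + 1` of the points `y i`; the `i`-th
word starts at position `i ^ 2`. -/
def concatBlocks (y : ℕ → ℕ → Bool) : ℕ → Bool :=
  fun p => y (Nat.sqrt p) (p - Nat.sqrt p ^ 2)

theorem concatBlocks_apply (y : ℕ → ℕ → Bool) {i t : ℕ} (ht : t < 2 * i + 1) :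
    concatBlocks y (i ^ 2 + t) = y i t := by
  have h : Nat.sqrt (i ^ 2 + t) = i := by
    rw [sq]
    exact Nat.sqrt_add_eq i (by omega)
  simp [concatBlocks, h]

theorem sum_range_sq (F : ℕ → ℝ) (n : ℕ) :
    ∑ p ∈ Finset.range (n ^ 2), F p =
      ∑ i ∈ Finset.range n, ∑ t ∈ Finset.range (2 * i + 1), F (i ^ 2 + t) := by
  induction n with
  | zero => simp
  | succ n ih =>
    rw [Finset.sum_range_succ, ← ih, ← Finset.sum_range_add]
    congr 2
    ring

/-- Along a block, the visits of the concatenated point and of the original point to a set that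
depends on the first `k` coordinates differ at most `k` times. -/
theorem abs_sum_block_sub_le_s10 {C : Set (ℕ → Bool)} {k : ℕ}
    (hk : ∀ ω ω' : ℕ → Bool, (∀ m < k, ω m = ω' m) → (ω ∈ C ↔ ω' ∈ C))
    (y : ℕ → ℕ → Bool) (i : ℕ) :
    |∑ t ∈ Finset.range (2 * i + 1),
      (C.indicator (1 : (ℕ → Bool) → ℝ) (binShift^[i ^ 2 + t] (concatBlocks y)) -
        C.indicator 1 (binShift^[t] (y i)))| ≤ k := by
  refine (Finset.abs_sum_le_sum_abs _ _).trans ?_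
  have hterm : ∀ t ∈ Finset.range (2 * i + 1),
      |C.indicator (1 : (ℕ → Bool) → ℝ) (binShift^[i ^ 2 + t] (concatBlocks y)) -
        C.indicator 1 (binShift^[t] (y i))| ≤ if 2 * i + 1 - k ≤ t then 1 else 0 := by
    intro t _
    split_ifs with h
    · by_cases h1 : binShift^[i ^ 2 + t] (concatBlocks y) ∈ C <;>
        by_cases h2 : binShift^[t] (y i) ∈ C <;> simp [h1, h2]
    · have hiff := hk (binShift^[i ^ 2 + t] (concatBlocks y)) (binShift^[t] (y i)) fun m hm => by
        rw [binShift_iterate_apply, binShift_iterate_apply, add_assoc,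
          concatBlocks_apply y (by omega)]
      rw [Set.indicator_apply, Set.indicator_apply, if_congr hiff rfl rfl]
      simp
  refine (Finset.sum_le_sum hterm).trans ?_
  rw [Finset.sum_boole]
  have hsub : (Finset.range (2 * i + 1)).filter (fun t => 2 * i + 1 - k ≤ t) ⊆
      Finset.Ico (2 * i + 1 - k) (2 * i + 1) := fun t => by
    simp only [Finset.mem_filter, Finset.mem_range, Finset.mem_Ico]
    tauto
  have hcard := Finset.card_le_card hsub
  rw [Nat.card_Ico] at hcard
  exact_mod_cast hcard.trans (by omega)

theorem integral_indicator_iterate {ν : Measure (ℕ → Bool)} (hν : MeasurePreserving binShift ν ν)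
    {C : Set (ℕ → Bool)} (hC : MeasurableSet C) (t : ℕ) :
    ∫ y, C.indicator (1 : (ℕ → Bool) → ℝ) (binShift^[t] y) ∂ν = ν.real C := by
  have ht := hν.iterate t
  calc ∫ y, C.indicator (1 : (ℕ → Bool) → ℝ) (binShift^[t] y) ∂ν
      = ∫ y, (binShift^[t] ⁻¹' C).indicator (1 : (ℕ → Bool) → ℝ) y ∂ν := rfl
    _ = ν.real C := by
      rw [integral_indicator_one (ht.measurable hC), measureReal_def,
        ht.measure_preimage hC.nullMeasurableSet, measureReal_def]

theorem integrable_indicator_iterate_s10 {ν : Measure (ℕ → Bool)} [IsProbabilityMeasure ν]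
    (hν : MeasurePreserving binShift ν ν) {C : Set (ℕ → Bool)} (hC : MeasurableSet C) (t : ℕ) :
    Integrable (fun y => C.indicator (1 : (ℕ → Bool) → ℝ) (binShift^[t] y)) ν :=
  (integrable_const (1 : ℝ)).indicator ((hν.iterate t).measurable hC)

theorem abs_indicator_one_sub_le_s10 {Ω : Type*} (C : Set Ω) (ω : Ω) {m : ℝ} (h0 : 0 ≤ m)
    (h1 : m ≤ 1) : |C.indicator (1 : Ω → ℝ) ω - m| ≤ 1 := by
  rw [abs_le]
  by_cases h : ω ∈ C
  · simp only [Set.indicator_of_mem h, Pi.one_apply]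
    constructor <;> linarith
  · simp only [Set.indicator_of_notMem h]
    constructor <;> linarith

/-- Partial sums of a sequence bounded by `1` are `o(N)` once those along the squares satisfy
a bound of order `n ^ (3 / 2)`, up to an error of order `n`. -/
theorem tendsto_sum_div_of_sq {F : ℕ → ℝ} (hF : ∀ p, |F p| ≤ 1) {T : ℕ → ℝ} {k K : ℝ}
    (hT : ∀ n, |∑ p ∈ Finset.range (n ^ 2), F p - T n| ≤ k * n)
    (hK : ∀ᶠ n : ℕ in atTop, T n ^ 2 ≤ K * (n : ℝ) ^ 3) :
    Tendsto (fun N : ℕ => (∑ p ∈ Finset.range N, F p) / N) atTop (nhds 0) := by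
  have hsqrt : Tendsto Nat.sqrt atTop atTop :=
    tendsto_atTop.2 fun b => (eventually_ge_atTop (b * b)).mono fun N hN => Nat.le_sqrt.2 hN
  have hlim : Tendsto (fun n : ℕ => (2 + k) / (n : ℝ) + √(K / n)) atTop (nhds 0) := by
    have h1 : Tendsto (fun n : ℕ => (2 + k) / (n : ℝ)) atTop (nhds 0) :=
      tendsto_const_div_atTop_nhds_zero_nat _
    have h2 : Tendsto (fun n : ℕ => √(K / (n : ℝ))) atTop (nhds 0) := by
      simpa using (tendsto_const_div_atTop_nhds_zero_nat K).sqrt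
    simpa using h1.add h2
  refine squeeze_zero_norm' ?_ (hlim.comp hsqrt)
  filter_upwards [hsqrt.eventually hK, hsqrt.eventually (eventually_gt_atTop 0)] with N hN hpos
  simp only [Function.comp_apply]
  have hle : Nat.sqrt N ^ 2 ≤ N := Nat.sqrt_le' N
  have hub : N ≤ Nat.sqrt N ^ 2 + 2 * Nat.sqrt N := by
    nlinarith [Nat.sqrt_le_add N]
  generalize Nat.sqrt N = n at hN hpos hle hub ⊢
  have hn0 : (0 : ℝ) < n := by exact_mod_cast hpos
  obtain ⟨r, rfl⟩ := Nat.exists_eq_add_of_le hle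
  have hr : (r : ℝ) ≤ 2 * n := by
    have : r ≤ 2 * n := by omega
    exact_mod_cast this
  have htail : |∑ t ∈ Finset.range r, F (n ^ 2 + t)| ≤ r := by
    refine (Finset.abs_sum_le_sum_abs _ _).trans ?_
    refine (Finset.sum_le_sum fun t _ => hF _).trans ?_
    simp
  have hTn : |T n| ≤ √(K / n) * (n : ℝ) ^ 2 := by
    have h1 : |T n| ≤ √(K / n * ((n : ℝ) ^ 2) ^ 2) := by
      refine Real.abs_le_sqrt (hN.trans_eq ?_)
      field_simp
    rwa [Real.sqrt_mul' _ (by positivity), Real.sqrt_sq (by positivity)] at h1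
  have htotal : |∑ p ∈ Finset.range (n ^ 2 + r), F p| ≤
      ((2 + k) / n + √(K / n)) * (n : ℝ) ^ 2 := by
    have h2 : ((2 + k) / n + √(K / n)) * (n : ℝ) ^ 2 =
        2 * n + k * n + √(K / n) * (n : ℝ) ^ 2 := by
      field_simp
    rw [Finset.sum_range_add, h2]
    have h3 := hT n
    rw [abs_le] at *
    constructor <;> linarith [h3.1, h3.2, htail.1, htail.2, hTn.1, hTn.2]
  have hN2 : (n : ℝ) ^ 2 ≤ ((n ^ 2 + r : ℕ) : ℝ) := by exact_mod_cast hle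
  have hN0 : (0 : ℝ) < ((n ^ 2 + r : ℕ) : ℝ) := lt_of_lt_of_le (by positivity) hN2
  have hcoef : 0 ≤ (2 + k) / n + √(K / n) :=
    nonneg_of_mul_nonneg_left ((abs_nonneg _).trans htotal) (by positivity)
  rw [Real.norm_eq_abs, abs_div, abs_of_pos hN0, div_le_iff₀ hN0]
  exact htotal.trans (mul_le_mul_of_nonneg_left hN2 hcoef)

theorem sum_range_odd_sq_le (n : ℕ) :
    ∑ i ∈ Finset.range n, (2 * (i : ℝ) + 1) ^ 2 ≤ 4 * (n : ℝ) ^ 3 := by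
  induction n with
  | zero => simp
  | succ n ih =>
    rw [Finset.sum_range_succ]
    push_cast
    have hn : (0 : ℝ) ≤ n := n.cast_nonneg
    nlinarith [sq_nonneg (n : ℝ)]

/-- Sigmund's theorem for the full binary shift: every shift-invariant Borel probability
measure `ν` on `{0,1}^ℕ` has a `({0, …, N-1})`-generic point: some `x` with
`(1/N)·#{0 ≤ i < N : σ^i x ∈ C} → ν(C)` for every cylinder `C`. -/
theorem sigmund_generic_point (ν : Measure (ℕ → Bool)) [IsProbabilityMeasure ν]
    (hν : MeasurePreserving binShift ν ν) :
    ∃ x : ℕ → Bool, ∀ C : Set (ℕ → Bool), IsCylinder C →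
      Tendsto
        (fun N : ℕ =>
          (((Finset.range N).filter (fun i => binShift^[i] x ∈ C)).card : ℝ) / N)
        atTop (nhds ((ν C).toReal)) := by
  obtain ⟨D, hD⟩ := countable_isCylinder.exists_eq_range
    ⟨Set.univ, 0, Fin.elim0, Fin.elim0, by simp⟩
  have hDmeas : ∀ j, MeasurableSet (D j) := fun j =>
    IsCylinder.measurableSet (show D j ∈ {C | IsCylinder C} from hD ▸ Set.mem_range_self j)
  have hint : ∀ j t, Integrable (fun y =>
      (D j).indicator (1 : (ℕ → Bool) → ℝ) (binShift^[t] y) - ν.real (D j)) ν := fun j t =>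
    (integrable_indicator_iterate_s10 hν (hDmeas j) t).sub (integrable_const _)
  obtain ⟨y, hy⟩ := exists_seq_sum_sq_le_s10 ν
    (fun n j y => ∑ t ∈ Finset.range (2 * n + 1),
      ((D j).indicator (1 : (ℕ → Bool) → ℝ) (binShift^[t] y) - ν.real (D j)))
    (fun n => 2 * n + 1)
    (fun n j => integrable_finsetSum _ fun t _ => hint j t)
    (fun n j => by
      rw [integral_finsetSum _ fun t _ => hint j t]
      refine Finset.sum_eq_zero fun t _ => ?_
      rw [integral_sub (integrable_indicator_iterate_s10 hν (hDmeas j) t) (integrable_const _),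
        integral_indicator_iterate hν (hDmeas j)]
      simp)
    (fun n j y => by
      refine (Finset.abs_sum_le_sum_abs _ _).trans ?_
      refine (Finset.sum_le_sum fun t _ =>
        abs_indicator_one_sub_le_s10 _ _ measureReal_nonneg measureReal_le_one).trans ?_
      simp)
  refine ⟨concatBlocks y, fun C hC => ?_⟩
  obtain ⟨k, hk⟩ := hC.exists_mem_iff
  obtain ⟨j, rfl⟩ : C ∈ Set.range D := hD ▸ hC
  obtain ⟨c, hc, hyc⟩ := hy j
  have hzero : Tendsto (fun N : ℕ => (∑ p ∈ Finset.range N,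
      ((D j).indicator (1 : (ℕ → Bool) → ℝ) (binShift^[p] (concatBlocks y)) - ν.real (D j))) / N)
      atTop (nhds 0) := by
    refine tendsto_sum_div_of_sq (k := k) (K := 10 / c)
      (fun p => abs_indicator_one_sub_le_s10 _ _ measureReal_nonneg measureReal_le_one)
      (T := fun n => ∑ i ∈ Finset.range n, ∑ t ∈ Finset.range (2 * i + 1),
        ((D j).indicator (1 : (ℕ → Bool) → ℝ) (binShift^[t] (y i)) - ν.real (D j)))
      (fun n => ?_) ?_
    · rw [sum_range_sq, ← Finset.sum_sub_distrib]
      refine (Finset.abs_sum_le_sum_abs _ _).trans ?_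
      refine (Finset.sum_le_sum (g := fun _ => (k : ℝ)) fun i _ => ?_).trans
        (by simp [mul_comm])
      rw [← Finset.sum_sub_distrib]
      simpa using abs_sum_block_sub_le_s10 hk y i
    · filter_upwards [eventually_gt_atTop j] with n hn
      have h1 := hyc n hn
      have h2 := sum_range_odd_sq_le n
      have h3 : (1 : ℝ) ≤ (n : ℝ) ^ 3 := one_le_pow₀ (by exact_mod_cast Nat.one_le_of_lt hn)
      rw [div_mul_eq_mul_div, le_div_iff₀ hc, mul_comm]
      linarith
  have hlim := hzero.add_const (ν.real (D j))
  rw [zero_add] at hlim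
  refine hlim.congr' ?_
  filter_upwards [eventually_gt_atTop 0] with N hN
  have hN0 : (N : ℝ) ≠ 0 := by positivity
  rw [Finset.sum_sub_distrib, Finset.sum_const, Finset.card_range, nsmul_eq_mul,
    Finset.card_filter]
  simp only [Set.indicator_apply, Pi.one_apply]
  push_cast
  field_simp
  ring
end
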